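/- Let X ⊂ ℝ^{n+1} be a convex surface, let ∅ ≠ F ⊆ X be closed, and set d_F(z) := inf_{y ∈ F} dist_X(z, y) for z ∈ X. Then for every standard chart (e,V) on X with associated convex function f, the function x ↦ (d_F(x + f(x)e))² is DC on V, i.e. it is the difference of two continuous convex functions on V. -/

import Mathlib

open scoped NNReal

open Set

/-- `f` is DC on the convex set `C`: a difference of two continuous convex functions on `C`. -/
def IsDCOn {E : Type*} [NormedAddCommGroup E] [NormedSpace ℝ E]
    (C : Set E) (f : E → ℝ) : Prop :=
  ∃ g h : E → ℝ, ConvexOn ℝ C g ∧ ConvexOn ℝ C h ∧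
    ContinuousOn g C ∧ ContinuousOn h C ∧ ∀ x ∈ C, f x = g x - h x

/-- A mapping `F : C → F'` is DC if `ℓ ∘ F` is DC for every linear functional `ℓ`. -/
def IsDCMapOn {E F' : Type*} [NormedAddCommGroup E] [NormedSpace ℝ E]
    [NormedAddCommGroup F'] [NormedSpace ℝ F'] (C : Set E) (F : E → F') : Prop :=
  ∀ ℓ : F' →ₗ[ℝ] ℝ, IsDCOn C (fun x => ℓ (F x))

/-- `F` is locally DC on the open set `U`: every point of `U` has an open convex
neighborhood contained in `U` on which `F` is DC. -/
def LocallyDCMapOn {E F' : Type*} [NormedAddCommGroup E] [NormedSpace ℝ E]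
    [NormedAddCommGroup F'] [NormedSpace ℝ F'] (U : Set E) (F : E → F') : Prop :=
  ∀ x ∈ U, ∃ V : Set E, IsOpen V ∧ Convex ℝ V ∧ x ∈ V ∧ V ⊆ U ∧ IsDCMapOn V F

/-- A convex body: a compact convex set with nonempty interior. -/
def IsConvexBody {E : Type*} [NormedAddCommGroup E] [NormedSpace ℝ E] (C : Set E) : Prop :=
  IsCompact C ∧ Convex ℝ C ∧ (interior C).Nonempty

/-- A convex surface: the boundary of a convex body. -/
def IsConvexSurface {E : Type*} [NormedAddCommGroup E] [NormedSpace ℝ E] (X : Set E) : Prop :=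
  ∃ C : Set E, IsConvexBody C ∧ X = frontier C

/-- The intrinsic distance on `X ⊆ E`: the infimum of lengths (total variations) of
continuous curves `γ : [0,1] → E` joining `a` and `b` within `X`. -/
noncomputable def intrinsicDist {E : Type*} [NormedAddCommGroup E] [NormedSpace ℝ E]
    (X : Set E) (a b : E) : ℝ :=
  (⨅ γ : {γ : ℝ → E // ContinuousOn γ (Set.Icc 0 1) ∧ γ 0 = a ∧ γ 1 = b ∧
      Set.MapsTo γ (Set.Icc 0 1) X},
    eVariationOn γ.1 (Set.Icc 0 1)).toReal

/-- An `(e,V)`-standard chart on `X`, given by a unit vector `e`, a convex open subset `V`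
of the hyperplane `e^⊥`, and a Lipschitz convex function `f : V → ℝ` whose graph
`{x + f(x)e : x ∈ V}` is a relatively open subset of `X`. -/
def IsStandardChart {E : Type*} [NormedAddCommGroup E] [InnerProductSpace ℝ E]
    (X : Set E) (e : E) (V : Set ↥((Submodule.span ℝ {e})ᗮ))
    (f : ↥((Submodule.span ℝ {e})ᗮ) → ℝ) : Prop :=
  ‖e‖ = 1 ∧ IsOpen V ∧ Convex ℝ V ∧ ConvexOn ℝ V f ∧
    (∃ K : ℝ≥0, LipschitzOnWith K f V) ∧
    ∃ O : Set E, IsOpen O ∧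
      (fun x : ↥((Submodule.span ℝ {e})ᗮ) => (x : E) + f x • e) '' V = X ∩ O

namespace ConvexSurface

open scoped RealInnerProductSpace

/-! ### Curves of bounded length -/

section Joined

variable {E : Type*} [NormedAddCommGroup E]

/-- `x` and `y` are joined in `S` by a continuous curve of length at most `L`. -/
def JoinedWithin (S : Set E) (x y : E) (L : ℝ) : Prop :=
  0 ≤ L ∧ ∃ γ : ℝ → E, ContinuousOn γ (Icc 0 1) ∧ γ 0 = x ∧ γ 1 = y ∧
    MapsTo γ (Icc 0 1) S ∧ eVariationOn γ (Icc 0 1) ≤ ENNReal.ofReal L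

lemma JoinedWithin.mono {S T : Set E} {x y : E} {L M : ℝ} (h : JoinedWithin S x y L)
    (hST : S ⊆ T) (hLM : L ≤ M) : JoinedWithin T x y M := by
  obtain ⟨h0, γ, hc, h1, h2, hm, hv⟩ := h
  exact ⟨h0.trans hLM, γ, hc, h1, h2, fun t ht => hST (hm ht),
    hv.trans (ENNReal.ofReal_le_ofReal hLM)⟩

lemma JoinedWithin.symm {S : Set E} {x y : E} {L : ℝ} (h : JoinedWithin S x y L) :
    JoinedWithin S y x L := by
  obtain ⟨h0, γ, hc, h1, h2, hm, hv⟩ := h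
  have hmap : MapsTo (fun t : ℝ => 1 - t) (Icc 0 1) (Icc 0 1) := by
    intro t ht
    constructor <;> linarith [ht.1, ht.2]
  refine ⟨h0, γ ∘ fun t => 1 - t, hc.comp (by fun_prop) hmap, by simp [h2], by simp [h1],
    hm.comp hmap, ?_⟩
  rw [eVariationOn.comp_eq_of_antitoneOn]
  · exact (eVariationOn.mono _ hmap.image_subset).trans hv
  · intro a _ b _ hab
    simp only
    linarith

lemma JoinedWithin.map {S T : Set E} {x y : E} {L : ℝ} (h : JoinedWithin S x y L)
    {g : E → E} {K : ℝ≥0} (hg : LipschitzOnWith K g S) (hgm : MapsTo g S T) :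
    JoinedWithin T (g x) (g y) (K * L) := by
  obtain ⟨h0, γ, hc, h1, h2, hm, hv⟩ := h
  refine ⟨by positivity, g ∘ γ, hg.continuousOn.comp hc hm, by simp [h1], by simp [h2],
    hgm.comp hm, (hg.comp_eVariationOn_le hm).trans ?_⟩
  rw [ENNReal.ofReal_mul (by positivity)]
  simp only [ENNReal.ofReal_coe_nnreal]
  gcongr

lemma JoinedWithin.trans {S : Set E} {x y z : E} {L M : ℝ} (h : JoinedWithin S x y L)
    (h' : JoinedWithin S y z M) : JoinedWithin S x z (L + M) := by
  obtain ⟨h0, γ, hc, h1, h2, hm, hv⟩ := h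
  obtain ⟨h0', γ', hc', h1', h2', hm', hv'⟩ := h'
  set η : ℝ → E := fun t => if t ≤ 1 / 2 then γ (2 * t) else γ' (2 * t - 1) with hη
  have e1 : EqOn η (γ ∘ fun t => 2 * t) (Icc 0 (1 / 2)) := by
    intro t ht
    simp only [hη, Function.comp]
    rw [if_pos ht.2]
  have e2 : EqOn η (γ' ∘ fun t => 2 * t - 1) (Icc (1 / 2) 1) := by
    intro t ht
    simp only [hη, Function.comp]
    split_ifs with h
    · have : t = 1 / 2 := le_antisymm h ht.1
      subst this
      norm_num [h2, h1']
    · rfl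
  have m1 : MapsTo (fun t : ℝ => 2 * t) (Icc 0 (1 / 2)) (Icc 0 1) := by
    intro t ht
    constructor <;> linarith [ht.1, ht.2]
  have m2 : MapsTo (fun t : ℝ => 2 * t - 1) (Icc (1 / 2) 1) (Icc 0 1) := by
    intro t ht
    constructor <;> linarith [ht.1, ht.2]
  have hU : Icc (0 : ℝ) 1 = Icc 0 (1 / 2) ∪ Icc (1 / 2) 1 :=
    (Icc_union_Icc_eq_Icc (by norm_num) (by norm_num)).symm
  refine ⟨by positivity, η, ?_, ?_, ?_, ?_, ?_⟩
  · rw [hU]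
    refine ContinuousOn.union_of_isClosed ?_ ?_ isClosed_Icc isClosed_Icc
    · exact (hc.comp (by fun_prop) m1).congr e1
    · exact (hc'.comp (by fun_prop) m2).congr e2
  · rw [e1 (by simp)]
    simp [h1]
  · rw [e2 (by norm_num)]
    norm_num [h2']
  · rw [hU]
    refine MapsTo.union ?_ ?_
    · exact (hm.comp m1).congr e1.symm
    · exact (hm'.comp m2).congr e2.symm
  · rw [hU, eVariationOn.union (x := 1 / 2) η (isGreatest_Icc (by norm_num))
      (isLeast_Icc (by norm_num)), eVariationOn.eq_of_eqOn e1, eVariationOn.eq_of_eqOn e2,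
      eVariationOn.comp_eq_of_monotoneOn, eVariationOn.comp_eq_of_monotoneOn,
      ENNReal.ofReal_add h0 h0']
    · exact add_le_add ((eVariationOn.mono _ m1.image_subset).trans hv)
        ((eVariationOn.mono _ m2.image_subset).trans hv')
    · intro a _ b _ hab
      simp only
      linarith
    · intro a _ b _ hab
      simp only
      linarith

end Joined

section Joined

variable {E : Type*} [NormedAddCommGroup E] [NormedSpace ℝ E]

lemma joinedWithin_segment {S : Set E} {x y : E} (h : segment ℝ x y ⊆ S) :
    JoinedWithin S x y ‖x - y‖ := by
  refine ⟨norm_nonneg _, AffineMap.lineMap x y, by fun_prop, by simp, by simp, ?_, ?_⟩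
  · intro t ht
    apply h
    rw [segment_eq_image_lineMap]
    exact ⟨t, ht, rfl⟩
  · have h1 : LipschitzOnWith (nndist x y) (AffineMap.lineMap x y : ℝ → E) univ :=
      (lipschitzWith_lineMap x y).lipschitzOnWith
    have h2 := h1.comp_eVariationOn_le (g := (id : ℝ → ℝ)) (s := Icc 0 1) (mapsTo_univ _ _)
    refine h2.trans ?_
    have h3 : eVariationOn (id : ℝ → ℝ) (Icc 0 1) ≤ ENNReal.ofReal (id 1 - id 0) := by
      simp
    calc _ ≤ (nndist x y : ENNReal) * ENNReal.ofReal (id 1 - id 0) := by gcongr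
      _ = _ := by
        simp only [id, sub_zero, ENNReal.ofReal_one, mul_one]
        rw [← dist_eq_norm, ← coe_nndist, ENNReal.ofReal_coe_nnreal]

lemma joinedWithin_of_convex {S A : Set E} (hA : Convex ℝ A) (hAS : A ⊆ S) {x y : E}
    (hx : x ∈ A) (hy : y ∈ A) : JoinedWithin S x y ‖x - y‖ :=
  joinedWithin_segment ((hA.segment_subset hx hy).trans hAS)

lemma intrinsicDist_nonneg (S : Set E) (x y : E) : 0 ≤ intrinsicDist S x y :=
  ENNReal.toReal_nonneg

lemma JoinedWithin.intrinsicDist_le {S : Set E} {x y : E} {L : ℝ} (h : JoinedWithin S x y L) :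
    intrinsicDist S x y ≤ L := by
  obtain ⟨h0, γ, hc, h1, h2, hm, hv⟩ := h
  refine ENNReal.toReal_le_of_le_ofReal h0 (le_trans ?_ hv)
  exact iInf_le (fun γ : {γ : ℝ → E // ContinuousOn γ (Set.Icc 0 1) ∧ γ 0 = x ∧ γ 1 = y ∧
      Set.MapsTo γ (Set.Icc 0 1) S} => eVariationOn γ.1 (Set.Icc 0 1)) ⟨γ, hc, h1, h2, hm⟩

lemma JoinedWithin.add_eps {S : Set E} {x y : E} {L : ℝ} (h : JoinedWithin S x y L)
    {ε : ℝ} (hε : 0 < ε) : JoinedWithin S x y (intrinsicDist S x y + ε) := by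
  obtain ⟨h0, γ, hc, h1, h2, hm, hv⟩ := h
  set I := ⨅ γ : {γ : ℝ → E // ContinuousOn γ (Set.Icc 0 1) ∧ γ 0 = x ∧ γ 1 = y ∧
      Set.MapsTo γ (Set.Icc 0 1) S}, eVariationOn γ.1 (Set.Icc 0 1) with hI
  have hd : intrinsicDist S x y = I.toReal := rfl
  have hfin : I ≠ ⊤ := ne_top_of_le_ne_top ENNReal.ofReal_ne_top
    ((iInf_le (fun γ : {γ : ℝ → E // ContinuousOn γ (Set.Icc 0 1) ∧ γ 0 = x ∧ γ 1 = y ∧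
      Set.MapsTo γ (Set.Icc 0 1) S} => eVariationOn γ.1 (Set.Icc 0 1))
      ⟨γ, hc, h1, h2, hm⟩).trans hv)
  have hlt : I < ENNReal.ofReal (intrinsicDist S x y + ε) := by
    rw [hd, ENNReal.ofReal_add ENNReal.toReal_nonneg hε.le, ENNReal.ofReal_toReal hfin]
    exact ENNReal.lt_add_right hfin (by simpa using hε)
  obtain ⟨⟨γ', hc', h1', h2', hm'⟩, hlt'⟩ := iInf_lt_iff.1 hlt
  exact ⟨by linarith [intrinsicDist_nonneg S x y], γ', hc', h1', h2', hm', hlt'.le⟩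

lemma JoinedWithin.intrinsicDist_le_add {S : Set E} {x y z : E} {L M : ℝ}
    (h : JoinedWithin S x y L) (h' : JoinedWithin S y z M) :
    intrinsicDist S x z ≤ intrinsicDist S x y + M := by
  refine le_of_forall_pos_le_add fun ε hε => ?_
  have := ((h.add_eps hε).trans h').intrinsicDist_le
  linarith

lemma JoinedWithin.intrinsicDist_comm {S : Set E} {x y : E} {L : ℝ}
    (h : JoinedWithin S x y L) : intrinsicDist S x y = intrinsicDist S y x := by
  refine le_antisymm (le_of_forall_pos_le_add fun ε hε => ?_)
    (le_of_forall_pos_le_add fun ε hε => ?_)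
  · exact (h.symm.add_eps hε).symm.intrinsicDist_le
  · exact (h.add_eps hε).symm.intrinsicDist_le

end Joined

/-! ### The complement of the interior of a convex set -/

section Outside

variable {E : Type*} [NormedAddCommGroup E] [InnerProductSpace ℝ E]

/-- The nearest point projection onto a complete convex set maps the outside to the frontier. -/
lemma exists_proj [CompleteSpace E] {C : Set E} (hC : IsClosed C) (hconv : Convex ℝ C)
    (hne : C.Nonempty) :
    ∃ π : E → E, LipschitzWith 1 π ∧ (∀ x ∈ C, π x = x) ∧
      ∀ x ∉ interior C, π x ∈ frontier C := by
  choose π hπ using fun u => exists_norm_eq_iInf_of_complete_convex hne hC.isComplete hconv u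
  have key : ∀ u, ∀ w ∈ C, ⟪u - π u, w - π u⟫ ≤ 0 := fun u =>
    (norm_eq_iInf_iff_real_inner_le_zero hconv (hπ u).1).1 (hπ u).2
  have hfix : ∀ x ∈ C, π x = x := by
    intro x hx
    have := key x x hx
    rw [real_inner_self_nonpos, sub_eq_zero] at this
    exact this.symm
  refine ⟨π, LipschitzWith.of_dist_le_mul fun x y => ?_, hfix, fun x hx => ?_⟩
  · simp only [NNReal.coe_one, one_mul, dist_eq_norm]
    have h1 := key x (π y) (hπ y).1
    have h2 := key y (π x) (hπ x).1
    have h3 : ⟪x - y, π x - π y⟫ - ⟪π x - π y, π x - π y⟫ =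
        -⟪x - π x, π y - π x⟫ - ⟪y - π y, π x - π y⟫ := by
      simp only [inner_sub_left, inner_sub_right]
      ring
    have h4 := real_inner_le_norm (x - y) (π x - π y)
    rw [real_inner_self_eq_norm_sq] at h3
    by_contra! hlt
    nlinarith [norm_nonneg (x - y), norm_nonneg (π x - π y)]
  · refine ⟨subset_closure (hπ x).1, fun hint => ?_⟩
    by_cases hxC : x ∈ C
    · rw [hfix x hxC] at hint
      exact hx hint
    have hne' : x - π x ≠ 0 := by
      rw [sub_ne_zero]
      intro h
      rw [h] at hxC
      exact hxC (hπ x).1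
    have hcont : Filter.Tendsto (fun t : ℝ => π x + t • (x - π x)) (nhdsWithin 0 (Ioi 0))
        (nhds (π x)) := by
      have : Continuous fun t : ℝ => π x + t • (x - π x) := by fun_prop
      simpa using (this.tendsto 0).mono_left nhdsWithin_le_nhds
    have hev := (hcont.eventually (isOpen_interior.mem_nhds hint)).and self_mem_nhdsWithin
    obtain ⟨t, ht, ht0⟩ := hev.exists
    have := key x _ (interior_subset ht)
    rw [add_sub_cancel_left, inner_smul_right, real_inner_self_eq_norm_sq] at this
    have h0 : 0 < ‖x - π x‖ := norm_pos_iff.2 hne'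
    have : 0 < t := ht0
    nlinarith [mul_pos this (pow_pos h0 2)]

lemma JoinedWithin.to_frontier [CompleteSpace E] {C : Set E} (hC : IsClosed C)
    (hconv : Convex ℝ C) {x y : E} (hx : x ∈ frontier C) (hy : y ∈ frontier C) {L : ℝ}
    (h : JoinedWithin (interior C)ᶜ x y L) : JoinedWithin (frontier C) x y L := by
  have hxC := hC.frontier_subset hx
  obtain ⟨π, hl, hfix, hfr⟩ := exists_proj hC hconv ⟨x, hxC⟩
  have := h.map (g := π) (T := frontier C) (hl.lipschitzOnWith) (fun z hz => hfr z hz)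
  rwa [hfix x hxC, hfix y (hC.frontier_subset hy), NNReal.coe_one, one_mul] at this

lemma intrinsicDist_frontier [CompleteSpace E] {C : Set E} (hC : IsClosed C)
    (hconv : Convex ℝ C) {x y : E} (hx : x ∈ frontier C) (hy : y ∈ frontier C) {L : ℝ}
    (h : JoinedWithin (interior C)ᶜ x y L) :
    intrinsicDist (frontier C) x y = intrinsicDist (interior C)ᶜ x y := by
  refine le_antisymm (le_of_forall_pos_le_add fun ε hε => ?_)
    (le_of_forall_pos_le_add fun ε hε => ?_)
  · exact ((h.add_eps hε).to_frontier hC hconv hx hy).intrinsicDist_le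
  · exact (((h.to_frontier hC hconv hx hy).add_eps hε).mono
      (fun z hz => hz.2) le_rfl).intrinsicDist_le

lemma radial_notMem_interior {C : Set E} (hconv : Convex ℝ C) {z x : E} (hz : z ∈ interior C)
    (hx : x ∉ interior C) {s : ℝ} (hs : 1 ≤ s) : z + s • (x - z) ∉ interior C := by
  intro h
  apply hx
  have hs0 : 0 < s := by linarith
  have : x = (1 - s⁻¹) • z + s⁻¹ • (z + s • (x - z)) := by
    rw [smul_add, smul_smul, inv_mul_cancel₀ hs0.ne']
    module
  rw [this]
  exact hconv.interior hz h (by rw [sub_nonneg]; exact inv_le_one_of_one_le₀ hs)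
    (by positivity) (by ring)

/-- A radial segment pointing away from an interior point stays outside. -/
lemma joinedWithin_radial {C : Set E} (hconv : Convex ℝ C) {z x : E} (hz : z ∈ interior C)
    (hx : x ∉ interior C) {s : ℝ} (hs : 1 ≤ s) :
    JoinedWithin (interior C)ᶜ x (z + s • (x - z)) ((s - 1) * ‖x - z‖) := by
  have h : JoinedWithin (interior C)ᶜ x (z + s • (x - z)) ‖x - (z + s • (x - z))‖ := by
    refine joinedWithin_segment ?_
    rw [segment_eq_image]
    rintro _ ⟨t, ht, rfl⟩
    have : (1 - t) • x + t • (z + s • (x - z)) = z + (1 + t * (s - 1)) • (x - z) := by module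
    simp only [this]
    exact radial_notMem_interior hconv hz hx (by nlinarith [ht.1])
  have e : x - (z + s • (x - z)) = -((s - 1) • (x - z)) := by module
  rwa [e, norm_neg, norm_smul, Real.norm_of_nonneg (by linarith)] at h

/-- Any two points outside a bounded convex set are joined there by a curve of controlled
length, if the dimension is at least two. -/
lemma joinedWithin_outside (hdim : ∀ u : E, ∃ w : E, ‖w‖ = 1 ∧ ⟪u, w⟫ = 0) {C : Set E}
    (hconv : Convex ℝ C) {z : E} (hz : z ∈ interior C) {R : ℝ} (hR : 0 < R)
    (hCR : C ⊆ Metric.closedBall z R) {x y : E} (hx : x ∉ interior C) (hy : y ∉ interior C)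
    (hxR : ‖x - z‖ ≤ R) (hyR : ‖y - z‖ ≤ R) :
    JoinedWithin (interior C)ᶜ x y (6 * R) := by
  have hhalf : ∀ u : E, ‖u‖ = 1 → {y : E | R ≤ ⟪u, y - z⟫} ⊆ (interior C)ᶜ := by
    intro u hu y hy hyC
    have h1 : y ∈ Metric.ball z R := by
      rw [← interior_closedBall z hR.ne']
      exact interior_mono hCR hyC
    rw [mem_ball_iff_norm] at h1
    have h2 := real_inner_le_norm u (y - z)
    rw [hu, one_mul] at h2
    exact absurd (hy.trans h2) (not_le.2 h1)
  have hhalfc : ∀ u : E, Convex ℝ {y : E | R ≤ ⟪u, y - z⟫} := by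
    intro u a ha b hb s t hs ht hst
    simp only [mem_ofPred_eq] at *
    have : s • a + t • b - z = s • (a - z) + t • (b - z) := by
      have : z = (s + t) • z := by rw [hst, one_smul]
      nth_rw 1 [this]
      module
    rw [this, inner_add_right, inner_smul_right, inner_smul_right]
    nlinarith
  have hnear : ∀ u v : E, ‖u‖ = 1 → ‖v‖ = 1 → 0 ≤ ⟪u, v⟫ →
      JoinedWithin (interior C)ᶜ (z + R • u) (z + R • v) (2 * R) := by
    intro u v hu hv huv
    have hu2 : ⟪u, u⟫ = 1 := by rw [real_inner_self_eq_norm_sq, hu]; norm_num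
    have hv2 : ⟪v, v⟫ = 1 := by rw [real_inner_self_eq_norm_sq, hv]; norm_num
    have a1 := joinedWithin_of_convex (x := z + R • u) (y := z + R • (u + v)) (hhalfc u)
      (hhalf u hu)
      (by simp [inner_smul_right, hu])
      (by simp only [mem_ofPred_eq, add_sub_cancel_left, inner_smul_right, inner_add_right, hu2]
          nlinarith)
    have a2 := joinedWithin_of_convex (x := z + R • (u + v)) (y := z + R • v) (hhalfc v)
      (hhalf v hv)
      (by simp only [mem_ofPred_eq, add_sub_cancel_left, inner_smul_right, inner_add_right, hv2,
            real_inner_comm u v]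
          nlinarith)
      (by simp [inner_smul_right, hv])
    refine (a1.trans a2).mono le_rfl ?_
    have e1 : z + R • u - (z + R • (u + v)) = -(R • v) := by module
    have e2 : z + R • (u + v) - (z + R • v) = R • u := by module
    rw [e1, e2, norm_neg, norm_smul, norm_smul, hu, hv, Real.norm_of_nonneg hR.le]
    linarith
  have hall : ∀ u v : E, ‖u‖ = 1 → ‖v‖ = 1 →
      JoinedWithin (interior C)ᶜ (z + R • u) (z + R • v) (4 * R) := by
    intro u v hu hv
    obtain ⟨w, hw, huw⟩ := hdim u
    have : ∃ w : E, ‖w‖ = 1 ∧ ⟪u, w⟫ = 0 ∧ 0 ≤ ⟪w, v⟫ := by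
      rcases le_total 0 ⟪w, v⟫ with h | h
      · exact ⟨w, hw, huw, h⟩
      · exact ⟨-w, by simpa, by simpa, by simpa⟩
    obtain ⟨w, hw, huw, hwv⟩ := this
    exact ((hnear u w hu hw huw.ge).trans (hnear w v hw hv hwv)).mono le_rfl (by linarith)
  have hrad : ∀ x, x ∉ interior C → ‖x - z‖ ≤ R → ∃ u : E, ‖u‖ = 1 ∧
      JoinedWithin (interior C)ᶜ x (z + R • u) R := by
    intro x hx hxR
    have h0 : 0 < ‖x - z‖ := by
      rw [norm_pos_iff, sub_ne_zero]
      rintro rfl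
      exact hx hz
    refine ⟨‖x - z‖⁻¹ • (x - z), by rw [norm_smul, norm_inv, norm_norm, inv_mul_cancel₀ h0.ne'],
      ?_⟩
    rw [smul_smul]
    refine (joinedWithin_radial hconv hz hx ?_).mono le_rfl ?_
    · rw [← div_eq_mul_inv, one_le_div h0]
      exact hxR
    · rw [sub_mul, mul_assoc, inv_mul_cancel₀ h0.ne']
      linarith
  obtain ⟨u, hu, h1⟩ := hrad x hx hxR
  obtain ⟨v, hv, h2⟩ := hrad y hy hyR
  exact ((h1.trans (hall u v hu hv)).trans h2.symm).mono le_rfl (by linarith)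

end Outside

/-! ### Polyhedra and polygonal chains in their boundary -/

section Poly

variable {E : Type*} [NormedAddCommGroup E] [InnerProductSpace ℝ E] {ι : Type*}

/-- The polyhedron cut out by the inequalities `⟪ν i, x⟫ ≤ c i`. -/
def poly (ν : ι → E) (c : ι → ℝ) : Set E := {x | ∀ i, ⟪ν i, x⟫ ≤ c i}

/-- The facet of `poly ν c` on the hyperplane `⟪ν i, x⟫ = c i`. -/
def facet (ν : ι → E) (c : ι → ℝ) (i : ι) : Set E := {x | x ∈ poly ν c ∧ ⟪ν i, x⟫ = c i}

variable {ν : ι → E} {c : ι → ℝ}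

lemma isClosed_poly : IsClosed (poly ν c) := by
  have : poly ν c = ⋂ i, {x | ⟪ν i, x⟫ ≤ c i} := by
    ext x
    simp [poly]
  rw [this]
  exact isClosed_iInter fun i => isClosed_le (by fun_prop) (by fun_prop)

lemma convex_halfspace_ge (v : E) (r : ℝ) : Convex ℝ {x : E | r ≤ ⟪v, x⟫} := by
  intro a ha b hb s t hs ht hst
  simp only [mem_ofPred_eq, inner_add_right, inner_smul_right] at *
  calc r = s * r + t * r := by rw [← add_mul, hst, one_mul]
    _ ≤ _ := by gcongr

lemma convex_poly : Convex ℝ (poly ν c) := by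
  intro a ha b hb s t hs ht hst i
  have h1 := ha i
  have h2 := hb i
  rw [inner_add_right, inner_smul_right, inner_smul_right]
  calc _ ≤ s * c i + t * c i := by gcongr
    _ = c i := by rw [← add_mul, hst, one_mul]

lemma isClosed_facet (i : ι) : IsClosed (facet ν c i) :=
  isClosed_poly.inter (isClosed_eq (f := fun x => ⟪ν i, x⟫) (by fun_prop) (by fun_prop))

lemma lt_of_mem_interior_poly (hν : ∀ i, ‖ν i‖ = 1) {x : E} (hx : x ∈ interior (poly ν c))
    (i : ι) : ⟪ν i, x⟫ < c i := by
  have hcont : Filter.Tendsto (fun t : ℝ => x + t • ν i) (nhdsWithin 0 (Ioi 0)) (nhds x) := by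
    have : Continuous fun t : ℝ => x + t • ν i := by fun_prop
    simpa using (this.tendsto 0).mono_left nhdsWithin_le_nhds
  have hev := (hcont.eventually (isOpen_interior.mem_nhds hx)).and self_mem_nhdsWithin
  obtain ⟨t, ht, ht0⟩ := hev.exists
  have := interior_subset ht i
  rw [inner_add_right, inner_smul_right, real_inner_self_eq_norm_sq, hν] at this
  have : 0 < t := ht0
  linarith

lemma halfspace_subset (hν : ∀ i, ‖ν i‖ = 1) (i : ι) :
    {x : E | c i ≤ ⟪ν i, x⟫} ⊆ (interior (poly ν c))ᶜ := fun _ hx hx' =>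
  absurd (lt_of_mem_interior_poly hν hx' i) (not_lt.2 hx)

lemma mem_interior_poly [Finite ι] {x : E} (h : ∀ i, ⟪ν i, x⟫ < c i) :
    x ∈ interior (poly ν c) := by
  rw [mem_interior]
  refine ⟨⋂ i, {x | ⟪ν i, x⟫ < c i}, fun y hy i => ?_, isOpen_iInter_of_finite fun i =>
    isOpen_lt (by fun_prop) (by fun_prop), by simpa using h⟩
  exact (mem_iInter.1 hy i).le

lemma exists_facet [Finite ι] {x : E} (hx : x ∈ frontier (poly ν c)) :
    ∃ i, x ∈ facet ν c i := by
  by_contra! h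
  have hx' := isClosed_poly.frontier_subset hx
  exact hx.2 (mem_interior_poly fun i => lt_of_le_of_ne (hx' i) fun h' => h i ⟨hx', h'⟩)

lemma joinedWithin_hyperplane (hν : ∀ i, ‖ν i‖ = 1) {i : ι} {x y : E} (hx : ⟪ν i, x⟫ = c i)
    (hy : ⟪ν i, y⟫ = c i) : JoinedWithin (interior (poly ν c))ᶜ x y ‖x - y‖ :=
  joinedWithin_of_convex (convex_halfspace_ge _ _) (halfspace_subset hν i) hx.ge hy.ge

/-- The pairs `(x, L)` such that some chain of `n` segments, each contained in a facet, joins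
`p` to `x` and has length `L`. -/
def chains (ν : ι → E) (c : ι → ℝ) (p : E) : ℕ → Set (E × ℝ)
  | 0 => {(p, 0)}
  | n + 1 => {q | ∃ r ∈ chains ν c p n, ∃ i, q.1 ∈ facet ν c i ∧ r.1 ∈ facet ν c i ∧
      q.2 = r.2 + ‖q.1 - r.1‖}

lemma isCompact_chains [Finite ι] (hK : IsCompact (poly ν c)) (p : E) (n : ℕ) :
    IsCompact (chains ν c p n) := by
  induction n with
  | zero => exact isCompact_singleton
  | succ n ih =>
    have h : chains ν c p (n + 1) = ⋃ i, (fun a : (E × ℝ) × E => (a.2, a.1.2 + ‖a.2 - a.1.1‖)) ''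
        ((chains ν c p n ∩ {r | r.1 ∈ facet ν c i}) ×ˢ facet ν c i) := by
      ext q
      simp only [chains, mem_iUnion, mem_image, mem_prod, mem_inter_iff, mem_ofPred_eq]
      constructor
      · rintro ⟨r, hr, i, h1, h2, h3⟩
        exact ⟨i, (r, q.1), ⟨⟨hr, h2⟩, h1⟩, by rw [← h3]⟩
      · rintro ⟨i, ⟨r, x⟩, ⟨⟨hr, h2⟩, h1⟩, rfl⟩
        exact ⟨r, hr, i, h1, h2, rfl⟩
    rw [h]
    refine isCompact_iUnion fun i => IsCompact.image ?_ (by fun_prop)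
    refine (ih.inter_right ((isClosed_facet i).preimage continuous_fst)).prod ?_
    exact hK.of_isClosed_subset (isClosed_facet i) fun x hx => hx.1

lemma chains_joinedWithin (hν : ∀ i, ‖ν i‖ = 1) {p : E}
    (hp : p ∈ frontier (poly ν c)) {n : ℕ} {q : E × ℝ} (hq : q ∈ chains ν c p n) :
    JoinedWithin (interior (poly ν c))ᶜ p q.1 q.2 := by
  induction n generalizing q with
  | zero =>
    obtain rfl : q = (p, 0) := hq
    have := joinedWithin_of_convex (convex_singleton p)
      (singleton_subset_iff.2 (show p ∈ (interior (poly ν c))ᶜ from hp.2)) rfl rfl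
    simpa using this
  | succ n ih =>
    obtain ⟨r, hr, i, h1, h2, h3⟩ := hq
    rw [h3, norm_sub_rev]
    exact (ih hr).trans (joinedWithin_hyperplane hν h2.2 h1.2)

lemma base_mem_chains [Finite ι] {p : E} (hp : p ∈ frontier (poly ν c)) (n : ℕ) :
    (p, (0 : ℝ)) ∈ chains ν c p n := by
  induction n with
  | zero => rfl
  | succ n ih =>
    obtain ⟨i, hi⟩ := exists_facet hp
    exact ⟨_, ih, i, hi, hi, by simp⟩

/-- A curve in a finite union of facets is at least as long as some chain with the same
endpoints, having at most as many segments as there are facets. -/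
lemma exists_chain_le [Finite ι] {p : E} (hp : p ∈ frontier (poly ν c)) {γ : ℝ → E}
    (h0 : γ 0 = p) (J : Finset ι) : ∀ s : ℝ, 0 ≤ s → ContinuousOn γ (Icc 0 s) →
      (∀ t ∈ Icc 0 s, ∃ i ∈ J, γ t ∈ facet ν c i) →
      ∃ L, (γ s, L) ∈ chains ν c p J.card ∧ ENNReal.ofReal L ≤ eVariationOn γ (Icc 0 s) ∧
        0 ≤ L := by
  classical
  induction hn : J.card generalizing J with
  | zero =>
    intro s hs _ h
    obtain ⟨i, hi, -⟩ := h s ⟨hs, le_rfl⟩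
    rw [Finset.card_eq_zero.1 hn] at hi
    exact absurd hi (Finset.notMem_empty i)
  | succ n ih =>
    intro s hs hγ h
    obtain ⟨i, hi, his⟩ := h s ⟨hs, le_rfl⟩
    set T : Set ℝ := Icc 0 s ∩ γ ⁻¹' facet ν c i with hT
    have hTc : IsCompact T := isCompact_Icc.of_isClosed_subset
      (hγ.preimage_isClosed_of_isClosed isClosed_Icc (isClosed_facet i)) inter_subset_left
    obtain ⟨t, ⟨ht, hti⟩, htl⟩ := hTc.exists_isLeast ⟨s, ⟨hs, le_rfl⟩, his⟩
    have hsub : Icc 0 t ⊆ Icc 0 s := Icc_subset_Icc le_rfl ht.2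
    have key : ∃ L, (γ t, L) ∈ chains ν c p n ∧
        ENNReal.ofReal L ≤ eVariationOn γ (Icc 0 t) ∧ 0 ≤ L := by
      rcases ht.1.eq_or_lt with h' | h'
      · rw [← h', h0]
        exact ⟨0, base_mem_chains hp n, by simp, le_rfl⟩
      · have hcard : (J.erase i).card = n := by rw [Finset.card_erase_of_mem hi, hn]; rfl
        refine ih (J.erase i) hcard t ht.1 (hγ.mono hsub) ?_
        have hcl : IsClosed (Icc 0 t ∩ γ ⁻¹' ⋃ j ∈ J.erase i, facet ν c j) :=
          (hγ.mono hsub).preimage_isClosed_of_isClosed isClosed_Icc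
            (isClosed_biUnion_finset fun j _ => isClosed_facet j)
        have hIco : Ico 0 t ⊆ Icc 0 t ∩ γ ⁻¹' ⋃ j ∈ J.erase i, facet ν c j := by
          intro r hr
          refine ⟨⟨hr.1, hr.2.le⟩, ?_⟩
          obtain ⟨j, hj, hjr⟩ := h r (hsub ⟨hr.1, hr.2.le⟩)
          refine mem_biUnion (x := j) (Finset.mem_erase.2 ⟨?_, hj⟩) hjr
          rintro rfl
          exact absurd (htl ⟨hsub ⟨hr.1, hr.2.le⟩, hjr⟩) (not_le.2 hr.2)
        have := hcl.closure_subset_iff.2 hIco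
        rw [closure_Ico h'.ne] at this
        intro r hr
        simpa using (this hr).2
    obtain ⟨L, hL, hLv, hL0⟩ := key
    refine ⟨L + ‖γ s - γ t‖, ⟨(γ t, L), hL, i, his, hti, rfl⟩, ?_, by positivity⟩
    rw [ENNReal.ofReal_add hL0 (norm_nonneg _)]
    have hadd := eVariationOn.Icc_add_Icc γ (s := Icc 0 s) ht.1 ht.2 ht
    rw [inter_eq_self_of_subset_right hsub, inter_self,
      inter_eq_self_of_subset_right (Icc_subset_Icc ht.1 le_rfl)] at hadd
    rw [← hadd]
    refine add_le_add hLv ?_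
    rw [← dist_eq_norm, ← edist_dist]
    exact eVariationOn.edist_le _ ⟨ht.2, le_rfl⟩ ⟨le_rfl, ht.2⟩

/-- Shortest curves in the boundary of a polyhedron exist and are polygonal. -/
lemma exists_minimal_chain [CompleteSpace E] [Finite ι] (hν : ∀ i, ‖ν i‖ = 1)
    (hK : IsCompact (poly ν c))
    {p x : E} (hp : p ∈ frontier (poly ν c)) (hx : x ∈ frontier (poly ν c)) {L₀ : ℝ}
    (h : JoinedWithin (interior (poly ν c))ᶜ p x L₀) :
    ∃ n, (x, intrinsicDist (interior (poly ν c))ᶜ p x) ∈ chains ν c p n := by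
  classical
  cases nonempty_fintype ι
  set n := (Finset.univ : Finset ι).card
  set S : Set ℝ := {L | (x, L) ∈ chains ν c p n} with hS
  have hSc : IsCompact S := by
    have : S = Prod.snd '' (chains ν c p n ∩ {r | r.1 = x}) := by
      ext L
      constructor
      · intro hL
        exact ⟨(x, L), ⟨hL, rfl⟩, rfl⟩
      · rintro ⟨⟨y, M⟩, ⟨h1, h2⟩, rfl⟩
        obtain rfl : y = x := h2
        exact h1
    rw [this]
    exact ((isCompact_chains hK p n).inter_right
      (isClosed_eq continuous_fst continuous_const)).image continuous_snd
  have hbelow : ∀ L, JoinedWithin (interior (poly ν c))ᶜ p x L → ∃ M ∈ S, M ≤ L := by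
    intro L hL
    obtain ⟨hL0, γ, hγ, h0, h1, hm, hv⟩ := hL.to_frontier isClosed_poly convex_poly hp hx
    obtain ⟨M, hM, hMv, -⟩ := exists_chain_le hp h0 Finset.univ 1 zero_le_one hγ fun t ht => by
      obtain ⟨i, hi⟩ := exists_facet (hm ht)
      exact ⟨i, Finset.mem_univ i, hi⟩
    rw [h1] at hM
    exact ⟨M, hM, (ENNReal.ofReal_le_ofReal_iff hL0).1 (hMv.trans hv)⟩
  obtain ⟨M, hM, -⟩ := hbelow _ h
  obtain ⟨L, hL, hLl⟩ := hSc.exists_isLeast ⟨M, hM⟩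
  refine ⟨n, ?_⟩
  have : intrinsicDist (interior (poly ν c))ᶜ p x = L := by
    refine le_antisymm (chains_joinedWithin hν hp hL).intrinsicDist_le
      (le_of_forall_pos_le_add fun ε hε => ?_)
    obtain ⟨M, hM, hMle⟩ := hbelow _ (h.add_eps hε)
    exact (hLl hM).trans hMle
  rw [this]
  exact hL

end Poly

/-! ### Unfolding shortest curves in the boundary of a polyhedron -/

section Unfold

variable {E : Type*} [NormedAddCommGroup E] [InnerProductSpace ℝ E] {ι : Type*}
  {ν : ι → E} {c : ι → ℝ}

lemma wbtw_of_local_min {A B q z : E} (hz : ‖A - z‖ + ‖z - B‖ = ‖A - B‖) {t : ℝ} (ht : 0 < t)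
    (ht1 : t ≤ 1) (hmin : ‖A - q‖ + ‖q - B‖ ≤
      ‖A - (q + t • (z - q))‖ + ‖q + t • (z - q) - B‖) : Wbtw ℝ A q B := by
  have e1 : A - (q + t • (z - q)) = (1 - t) • (A - q) + t • (A - z) := by module
  have e2 : q + t • (z - q) - B = (1 - t) • (q - B) + t • (z - B) := by module
  have h1 : ‖A - (q + t • (z - q))‖ ≤ (1 - t) * ‖A - q‖ + t * ‖A - z‖ := by
    rw [e1]
    refine (norm_add_le _ _).trans ?_
    rw [norm_smul, norm_smul, Real.norm_of_nonneg ht.le, Real.norm_of_nonneg (by linarith)]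
  have h2 : ‖q + t • (z - q) - B‖ ≤ (1 - t) * ‖q - B‖ + t * ‖z - B‖ := by
    rw [e2]
    refine (norm_add_le _ _).trans ?_
    rw [norm_smul, norm_smul, Real.norm_of_nonneg ht.le, Real.norm_of_nonneg (by linarith)]
  have h3 : t * (‖A - q‖ + ‖q - B‖) ≤ t * ‖A - B‖ := by
    rw [← hz]
    linarith
  have h4 := le_of_mul_le_mul_left h3 ht
  rw [← dist_add_dist_eq_iff, dist_eq_norm, dist_eq_norm, dist_eq_norm]
  refine le_antisymm h4 ?_
  simpa using norm_add_le (A - q) (q - B)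

/-- Near `x`, and on some facet hyperplane through `x`, the function `ρ` is bounded by the
Euclidean distance from a point `P` of that hyperplane, with equality at `x`. -/
def UnfoldsAt (ν : ι → E) (c : ι → ℝ) (ρ : E → ℝ) (x : E) : Prop :=
  ∃ i P, x ∈ facet ν c i ∧ ⟪ν i, P⟫ = c i ∧ ‖P - x‖ = ρ x ∧
    (∃ s : ℝ, 0 < s ∧ x + s • (P - x) ∈ poly ν c) ∧
    ∃ ε : ℝ, 0 < ε ∧ ∀ y, ⟪ν i, y⟫ = c i → ‖y - x‖ < ε → ρ y ≤ ‖P - y‖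

lemma UnfoldsAt.of_wbtw {ρ : E → ℝ} {x y P : E} {j : ι} (hx : x ∈ facet ν c j)
    (hy : y ∈ facet ν c j) (hxy : x ≠ y) (hP : ⟪ν j, P⟫ = c j) (hPy : ‖P - y‖ = ρ y)
    (hρ : ρ x = ρ y + ‖x - y‖) (hw : Wbtw ℝ P y x)
    (hloc : ∃ ε : ℝ, 0 < ε ∧ ∀ y', ⟪ν j, y'⟫ = c j → ‖y' - x‖ < ε → ρ y' ≤ ‖P - y'‖) :
    UnfoldsAt ν c ρ x := by
  refine ⟨j, P, hx, hP, ?_, ?_, hloc⟩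
  · have := dist_add_dist_eq_iff.2 hw
    rw [dist_eq_norm, dist_eq_norm, dist_eq_norm, hPy, norm_sub_rev y x] at this
    rw [hρ, ← this]
  · obtain ⟨τ, hτ, rfl⟩ := hw
    refine ⟨1 - τ, ?_, ?_⟩
    · rcases hτ.2.lt_or_eq with h | h
      · linarith
      · subst h
        simp at hxy
    · have : x + (1 - τ) • (P - x) = AffineMap.lineMap P x τ := by
        rw [AffineMap.lineMap_apply_module]
        module
      rw [this]
      exact hy.1

lemma exists_small_step (v : E) {ε : ℝ} (hε : 0 < ε) :
    ∃ t : ℝ, 0 < t ∧ t ≤ 1 ∧ ‖t • v‖ < ε := by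
  refine ⟨min 1 (ε / (‖v‖ + 1)), by positivity, min_le_left _ _, ?_⟩
  rw [norm_smul, Real.norm_of_nonneg (by positivity)]
  calc _ ≤ ε / (‖v‖ + 1) * ‖v‖ := by gcongr; exact min_le_right _ _
    _ < ε / (‖v‖ + 1) * (‖v‖ + 1) := by gcongr; linarith
    _ = ε := by field_simp

/-- Reflection unfolds one facet hyperplane onto another one, fixing their intersection. -/
lemma exists_unfold (hν : ∀ i, ‖ν i‖ = 1) {i j : ι} (hij : ν i + ν j ≠ 0) {P : E}
    (hP : ⟪ν i, P⟫ = c i) :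
    ∃ P', ⟪ν j, P'⟫ = c j ∧ ⟪ν i, P'⟫ = c i - (⟪ν j, P⟫ - c j) ∧
      ∀ r, ⟪ν i, r⟫ = c i → ⟪ν j, r⟫ = c j → ‖P' - r‖ = ‖P - r‖ := by
  have hii : ⟪ν i, ν i⟫ = 1 := by rw [real_inner_self_eq_norm_sq, hν]; norm_num
  have hjj : ⟪ν j, ν j⟫ = 1 := by rw [real_inner_self_eq_norm_sq, hν]; norm_num
  have hji : ⟪ν j, ν i⟫ = ⟪ν i, ν j⟫ := real_inner_comm _ _
  have hk : 1 + ⟪ν i, ν j⟫ ≠ 0 := by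
    intro h
    apply hij
    rw [← norm_eq_zero, ← sq_eq_zero_iff, ← real_inner_self_eq_norm_sq]
    simp only [inner_add_left, inner_add_right, hii, hjj, hji]
    linarith
  set t : ℝ := (⟪ν j, P⟫ - c j) / (1 + ⟪ν i, ν j⟫) with ht
  have htk : t * (1 + ⟪ν i, ν j⟫) = ⟪ν j, P⟫ - c j := div_mul_cancel₀ _ hk
  refine ⟨P - t • (ν i + ν j), ?_, ?_, fun r hri hrj => ?_⟩
  · simp only [inner_sub_right, inner_smul_right, inner_add_right, hjj, hji]
    linarith
  · simp only [inner_sub_right, inner_smul_right, inner_add_right, hii, hP]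
    linarith
  · have h : ‖P - t • (ν i + ν j) - r‖ ^ 2 = ‖P - r‖ ^ 2 := by
      have e : P - t • (ν i + ν j) - r = (P - r) - t • (ν i + ν j) := by abel
      rw [e, norm_sub_sq_real, inner_smul_right, norm_smul, mul_pow,
        ← real_inner_self_eq_norm_sq (ν i + ν j)]
      have e1 : ⟪P - r, ν i⟫ = 0 := by
        rw [real_inner_comm, inner_sub_right, hP, hri, sub_self]
      have e2 : ⟪P - r, ν j⟫ = ⟪ν j, P⟫ - c j := by
        rw [real_inner_comm, inner_sub_right, hrj]
      simp only [inner_add_left, inner_add_right, hii, hjj, hji, e1, e2, Real.norm_eq_abs, sq_abs]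
      rw [← htk]
      ring
    exact (sq_eq_sq₀ (norm_nonneg _) (norm_nonneg _)).1 h

lemma UnfoldsAt.step (hν : ∀ i, ‖ν i‖ = 1) {z : E} (hz : ∀ i, ⟪ν i, z⟫ < c i) {p x y : E}
    {L : ℝ} (hpy : JoinedWithin (interior (poly ν c))ᶜ p y L)
    (hU : UnfoldsAt ν c (intrinsicDist (interior (poly ν c))ᶜ p) y) {j : ι}
    (hx : x ∈ facet ν c j) (hy : y ∈ facet ν c j)
    (hρ : intrinsicDist (interior (poly ν c))ᶜ p x =
      intrinsicDist (interior (poly ν c))ᶜ p y + ‖x - y‖) :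
    UnfoldsAt ν c (intrinsicDist (interior (poly ν c))ᶜ p) x := by
  by_cases hxy : x = y
  · rwa [hxy]
  set ρ := intrinsicDist (interior (poly ν c))ᶜ p with hρdef
  obtain ⟨i, P, hyi, hP, hPy, ⟨s, hs, hsK⟩, ε, hε, hloc⟩ := hU
  have hplane : ∀ k a b, ⟪ν k, a⟫ = c k → ⟪ν k, b⟫ = c k →
      (∃ M, JoinedWithin (interior (poly ν c))ᶜ p a M) → ρ b ≤ ρ a + ‖a - b‖ := by
    rintro k a b ha hb ⟨M, hM⟩
    exact hM.intrinsicDist_le_add (joinedWithin_hyperplane hν ha hb)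
  have hjoin : ∀ k b, ⟪ν k, y⟫ = c k → ⟪ν k, b⟫ = c k →
      ∃ M, JoinedWithin (interior (poly ν c))ᶜ p b M := fun k b h1 h2 =>
    ⟨_, hpy.trans (joinedWithin_hyperplane hν h1 h2)⟩
  by_cases hxi : ⟪ν i, x⟫ = c i
  · -- the curve goes straight on in the hyperplane of facet `i`
    have hxfi : x ∈ facet ν c i := ⟨hx.1, hxi⟩
    obtain ⟨t, ht, ht1, htε⟩ := exists_small_step (P - y) hε
    have hyt : ⟪ν i, y + t • (P - y)⟫ = c i := by
      rw [inner_add_right, inner_smul_right, inner_sub_right, hP, hyi.2]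
      ring
    have hw : Wbtw ℝ P y x := by
      refine wbtw_of_local_min (z := P) (by simp) ht ht1 ?_
      have h1 := hloc _ hyt (by simpa using htε)
      have h2 := hplane i _ x hyt hxi (hjoin i _ hyi.2 hyt)
      rw [hPy, norm_sub_rev y x, ← hρ]
      linarith
    refine UnfoldsAt.of_wbtw hxfi hyi hxy hP hPy hρ hw ⟨ε, hε, fun y' hy' hd => ?_⟩
    obtain ⟨τ, hτ, hτy⟩ := hw
    rw [AffineMap.lineMap_apply_module'] at hτy
    set w := P + τ • (y' - P) with hwdef
    have hwi : ⟪ν i, w⟫ = c i := by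
      rw [hwdef, inner_add_right, inner_smul_right, inner_sub_right, hP, hy']
      ring
    have hwy : ‖w - y‖ < ε := by
      have : w - y = τ • (y' - x) := by
        rw [hwdef, ← hτy]
        module
      rw [this, norm_smul, Real.norm_of_nonneg hτ.1]
      nlinarith [hτ.2, norm_nonneg (y' - x)]
    have h1 := hloc w hwi hwy
    have h2 := hplane i w y' hwi hy' (hjoin i w hyi.2 hwi)
    have e1 : P - w = τ • (P - y') := by rw [hwdef]; module
    have e2 : w - y' = (1 - τ) • (P - y') := by rw [hwdef]; module
    rw [e1, norm_smul, Real.norm_of_nonneg hτ.1] at h1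
    rw [e2, norm_smul, Real.norm_of_nonneg (by linarith [hτ.2])] at h2
    linarith
  · -- the curve crosses from facet `i` to facet `j`
    have hxlt : ⟪ν i, x⟫ < c i := lt_of_le_of_ne (hx.1 i) hxi
    have hij : ν i + ν j ≠ 0 := by
      intro h
      have hνj : ν j = -ν i := (neg_eq_of_add_eq_zero_right h).symm
      have h1 := hy.2
      have h2 := hz j
      rw [hνj, inner_neg_left, hyi.2] at h1
      rw [hνj, inner_neg_left] at h2
      linarith [hz i]
    obtain ⟨P', hP'j, hP'i, hP'r⟩ := exists_unfold hν hij hP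
    have hPj : ⟪ν j, P⟫ ≤ c j := by
      have := hsK j
      rw [inner_add_right, inner_smul_right, inner_sub_right, hy.2] at this
      by_contra! h
      nlinarith
    set a : E → ℝ := fun v => c i - ⟪ν i, v⟫ with ha
    have haP' : a P' ≤ 0 := by simp only [ha, hP'i]; linarith
    have hax : 0 < a x := by simp only [ha]; linarith
    have hacont : Continuous a := by fun_prop
    set τ : E → ℝ := fun v => -a P' / (a v - a P') with hτdef
    set cross : E → E := fun v => P' + τ v • (v - P') with hcross
    have hτ0 : ∀ v, 0 < a v → 0 ≤ τ v ∧ τ v ≤ 1 := by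
      intro v hv
      refine ⟨div_nonneg (by linarith) (by linarith), ?_⟩
      rw [hτdef, div_le_one (by linarith)]
      linarith
    have haff : ∀ (r : ℝ) (v : E), a (P' + r • (v - P')) = a P' + r * (a v - a P') := by
      intro r v
      simp only [ha, inner_add_right, inner_smul_right, inner_sub_right]
      ring
    have hci : ∀ v, 0 < a v → ⟪ν i, cross v⟫ = c i := by
      intro v hv
      have h1 : a (cross v) = 0 := by
        rw [hcross, haff, hτdef]
        have : a v - a P' ≠ 0 := by linarith
        simp only
        rw [div_mul_cancel₀ _ this]
        ring
      simp only [ha] at h1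
      linarith
    have hcj : ∀ v, ⟪ν j, v⟫ = c j → ⟪ν j, cross v⟫ = c j := by
      intro v hv
      rw [hcross, inner_add_right, inner_smul_right, inner_sub_right, hP'j, hv]
      ring
    have hsplit : ∀ v, 0 < a v → ‖P' - cross v‖ + ‖cross v - v‖ = ‖P' - v‖ := by
      intro v hv
      have e1 : P' - cross v = τ v • (P' - v) := by rw [hcross]; module
      have e2 : cross v - v = (1 - τ v) • (P' - v) := by rw [hcross]; module
      rw [e1, e2, norm_smul, norm_smul, Real.norm_of_nonneg (hτ0 v hv).1,
        Real.norm_of_nonneg (by linarith [(hτ0 v hv).2])]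
      ring
    obtain ⟨t, ht, ht1, htε⟩ := exists_small_step (cross x - y) hε
    have hyt : ∀ k, ⟪ν k, y⟫ = c k → ⟪ν k, cross x⟫ = c k →
        ⟪ν k, y + t • (cross x - y)⟫ = c k := by
      intro k h1 h2
      rw [inner_add_right, inner_smul_right, inner_sub_right, h1, h2]
      ring
    have hyti := hyt i hyi.2 (hci x hax)
    have hytj := hyt j hy.2 (hcj x hx.2)
    have hw : Wbtw ℝ P' y x := by
      refine wbtw_of_local_min (hsplit x hax) ht ht1 ?_
      have h1 := hloc _ hyti (by simpa using htε)
      have h2 := hplane j _ x hytj hx.2 (hjoin j _ hy.2 hytj)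
      rw [hP'r _ hyi.2 hy.2, hP'r _ hyti hytj, hPy, norm_sub_rev y x, ← hρ]
      linarith
    have hcrossx : cross x = y := by
      obtain ⟨r, hr, hry⟩ := hw
      rw [AffineMap.lineMap_apply_module', add_comm] at hry
      have h1 : a y = 0 := by simp only [ha, hyi.2, sub_self]
      rw [← hry, haff] at h1
      have : r = τ x := by
        rw [hτdef]
        simp only
        rw [eq_div_iff (by linarith)]
        linarith
      rw [hcross, ← hry, this]
    refine UnfoldsAt.of_wbtw hx hy hxy hP'j (by rw [hP'r _ hyi.2 hy.2, hPy]) hρ hw ?_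
    have hcc : ContinuousAt cross x := by
      have hτc : ContinuousAt τ x :=
        ContinuousAt.div (by fun_prop) (by fun_prop) (by linarith)
      exact continuousAt_const.add (hτc.smul (by fun_prop))
    have hev : ∀ᶠ v in nhds x, 0 < a v ∧ ‖cross v - y‖ < ε := by
      refine (hacont.continuousAt.eventually (lt_mem_nhds hax)).and ?_
      have : Filter.Tendsto (fun v => ‖cross v - y‖) (nhds x) (nhds 0) := by
        have h := (hcc.tendsto.sub_const y).norm
        rwa [hcrossx, sub_self, norm_zero] at h
      exact this.eventually (gt_mem_nhds hε)
    obtain ⟨δ, hδ, hδv⟩ := Metric.eventually_nhds_iff.1 hev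
    refine ⟨δ, hδ, fun y' hy' hd => ?_⟩
    obtain ⟨hay, hny⟩ := hδv (by rwa [dist_eq_norm])
    have h1 := hloc _ (hci y' hay) hny
    have h2 := hplane j _ y' (hcj y' hy') hy' (hjoin j _ hy.2 (hcj y' hy'))
    rw [← hP'r _ (hci y' hay) (hcj y' hy')] at h1
    linarith [hsplit y' hay]

/-- The distance from `p` unfolds at every point of the boundary of a polyhedron. -/
theorem unfoldsAt_of_mem_frontier [CompleteSpace E] [Finite ι] (hν : ∀ i, ‖ν i‖ = 1)
    (hK : IsCompact (poly ν c)) {z : E} (hz : ∀ i, ⟪ν i, z⟫ < c i) {p x : E}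
    (hp : p ∈ frontier (poly ν c)) (hx : x ∈ frontier (poly ν c)) {L₀ : ℝ}
    (h : JoinedWithin (interior (poly ν c))ᶜ p x L₀) :
    UnfoldsAt ν c (intrinsicDist (interior (poly ν c))ᶜ p) x := by
  obtain ⟨n, hn⟩ := exists_minimal_chain hν hK hp hx h
  set ρ := intrinsicDist (interior (poly ν c))ᶜ p with hρ
  have main : ∀ n, ∀ q ∈ chains ν c p n, q.2 = ρ q.1 → UnfoldsAt ν c ρ q.1 := by
    intro n
    induction n with
    | zero =>
      rintro q rfl h0
      obtain ⟨i, hi⟩ := exists_facet hp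
      refine ⟨i, p, hi, hi.2, by rw [← h0, sub_self, norm_zero], ⟨1, one_pos, by simpa using hi.1⟩,
        1, one_pos, fun y hy _ => ?_⟩
      exact (joinedWithin_hyperplane hν hi.2 hy).intrinsicDist_le
    | succ n ih =>
      rintro q ⟨r, hr, j, hqj, hrj, hqr⟩ hq
      have hjr := chains_joinedWithin hν hp hr
      have h1 : ρ r.1 ≤ r.2 := hjr.intrinsicDist_le
      have h2 := hjr.intrinsicDist_le_add (joinedWithin_hyperplane hν hrj.2 hqj.2)
      rw [norm_sub_rev] at h2
      have h3 : r.2 = ρ r.1 := by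
        refine le_antisymm ?_ h1
        simp only [← hρ] at h2
        linarith
      exact UnfoldsAt.step hν hz hjr (ih r hr h3) hqj hrj (by rw [← hρ, ← hq, hqr, h3])
  exact main n _ hn rfl

end Unfold

/-! ### Concavity along a segment over a polyhedron -/

section Segment

lemma le_of_locally_concave {G : ℝ → ℝ} (hc : ContinuousOn G (Icc 0 1))
    (hl : ∀ τ ∈ Ioo (0 : ℝ) 1, ∃ ε > 0, ∀ s ∈ Ioo 0 ε, G (τ + s) + G (τ - s) ≤ 2 * G τ) {τ : ℝ}
    (hτ : τ ∈ Icc (0 : ℝ) 1) : (1 - τ) * G 0 + τ * G 1 ≤ G τ := by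
  by_contra! hlt
  set d := (1 - τ) * G 0 + τ * G 1 - G τ with hd
  have hdpos : 0 < d := by linarith
  let J : ℝ → ℝ := fun t => G t - ((1 - t) * G 0 + t * G 1) + d * (t * (1 - t))
  have hJc : ContinuousOn J (Icc 0 1) := by
    have : ContinuousOn (fun t : ℝ => (1 - t) * G 0 + t * G 1) (Icc 0 1) := by fun_prop
    exact (hc.sub this).add (by fun_prop)
  obtain ⟨t, ht, htmin⟩ := isCompact_Icc.exists_isMinOn ⟨τ, hτ⟩ hJc
  have hJτ : J τ < 0 := by
    simp only [J]
    nlinarith [hτ.1, hτ.2, sq_nonneg (τ - 1 / 2)]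
  have hJt : J t < 0 := (htmin hτ).trans_lt hJτ
  have ht0 : 0 < t := ht.1.lt_of_ne (by rintro rfl; simp [J] at hJt)
  have ht1 : t < 1 := ht.2.lt_of_ne (by rintro rfl; simp [J] at hJt)
  obtain ⟨ε, hε, h⟩ := hl t ⟨ht0, ht1⟩
  obtain ⟨s, hs0, hs⟩ := exists_between (lt_min hε (lt_min ht0 (sub_pos.2 ht1)))
  have hs1 := hs.trans_le (min_le_left _ _)
  have hs2 := (hs.trans_le (min_le_right _ _)).trans_le (min_le_left _ _)
  have hs3 := (hs.trans_le (min_le_right _ _)).trans_le (min_le_right _ _)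
  have h0 := h s ⟨hs0, hs1⟩
  have h1 : J t ≤ J (t + s) := htmin ⟨by linarith, by linarith⟩
  have h2 : J t ≤ J (t - s) := htmin ⟨by linarith, by linarith⟩
  simp only [J] at h1 h2
  have : 0 < d * s ^ 2 := by positivity
  nlinarith

variable {E : Type*} [NormedAddCommGroup E] [InnerProductSpace ℝ E] {ι : Type*}
  {ν : ι → E} {c : ι → ℝ}

lemma exists_slope {x₀ h e : E} (he : ‖e‖ = 1) {F : ℝ → ℝ} {Λ : ℝ}
    (hmem : ∀ τ ∈ Icc (0 : ℝ) 1, x₀ + τ • h + F τ • e ∈ poly ν c)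
    (hbelow : ∀ τ ∈ Icc (0 : ℝ) 1, ∀ t ≤ F τ, x₀ + τ • h + t • e ∈ (interior (poly ν c))ᶜ)
    {τ : ℝ} {i : ι} (hi : ⟪ν i, x₀ + τ • h + F τ • e⟫ = c i)
    (hslope : ⟪ν i, e⟫ < 0 ∧ |⟪ν i, h⟫| ≤ Λ * ‖h‖ * -⟪ν i, e⟫) :
    ∃ κ : ℝ, |κ| ≤ Λ * ‖h‖ ∧ ∀ τ' ∈ Icc (0 : ℝ) 1, 0 ≤ F τ' - F τ - (τ' - τ) * κ ∧
      ⟪ν i, x₀ + τ • h + F τ • e + (τ' - τ) • (h + κ • e)⟫ = c i ∧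
      JoinedWithin (interior (poly ν c))ᶜ (x₀ + τ • h + F τ • e + (τ' - τ) • (h + κ • e))
        (x₀ + τ' • h + F τ' • e) (F τ' - F τ - (τ' - τ) * κ) := by
  obtain ⟨hneg, hle⟩ := hslope
  have hne : ⟪ν i, e⟫ ≠ 0 := hneg.ne
  refine ⟨-⟪ν i, h⟫ / ⟪ν i, e⟫, ?_, fun τ' hτ' => ?_⟩
  · rw [abs_div, abs_neg, abs_of_neg hneg, div_le_iff₀ (by linarith)]
    exact hle
  set κ := -⟪ν i, h⟫ / ⟪ν i, e⟫ with hκ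
  have hz : ⟪ν i, h⟫ + κ * ⟪ν i, e⟫ = 0 := by
    rw [hκ]
    field_simp
    ring
  have hplane : ⟪ν i, x₀ + τ • h + F τ • e + (τ' - τ) • (h + κ • e)⟫ = c i := by
    rw [inner_add_right, hi, inner_smul_right, inner_add_right, inner_smul_right, hz]
    ring
  have hv : x₀ + τ • h + F τ • e + (τ' - τ) • (h + κ • e)
      = x₀ + τ' • h + (F τ + (τ' - τ) * κ) • e := by module
  have hδ : 0 ≤ F τ' - F τ - (τ' - τ) * κ := by
    have h1 := hmem τ' hτ' i
    rw [← hplane, hv, inner_add_right, inner_add_right (𝕜 := ℝ) (ν i) (x₀ + τ' • h) ((F τ + _) • e),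
      inner_smul_right, inner_smul_right] at h1
    by_contra! hcon
    nlinarith
  refine ⟨hδ, hplane, ?_⟩
  rw [hv]
  have := joinedWithin_segment (S := (interior (poly ν c))ᶜ)
    (x := x₀ + τ' • h + (F τ + (τ' - τ) * κ) • e) (y := x₀ + τ' • h + F τ' • e) (by
      rw [segment_eq_image']
      rintro _ ⟨θ, hθ, rfl⟩
      have : x₀ + τ' • h + (F τ + (τ' - τ) * κ) • e + θ • (x₀ + τ' • h + F τ' • e -
          (x₀ + τ' • h + (F τ + (τ' - τ) * κ) • e)) =
          x₀ + τ' • h + (F τ + (τ' - τ) * κ + θ * (F τ' - F τ - (τ' - τ) * κ)) • e := by module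
      beta_reduce
      rw [this]
      refine hbelow τ' hτ' _ ?_
      nlinarith [hθ.1, hθ.2])
  refine this.mono subset_rfl (le_of_eq ?_)
  have : x₀ + τ' • h + (F τ + (τ' - τ) * κ) • e - (x₀ + τ' • h + F τ' • e) =
      (-(F τ' - F τ - (τ' - τ) * κ)) • e := by module
  rw [this, norm_smul, he, mul_one, norm_neg, Real.norm_of_nonneg hδ]

set_option maxHeartbeats 1000000 in
/-- Along a segment in the lower part of the boundary of a polyhedron, the squared distance from
`p` becomes concave after subtracting an explicit convex function. -/
theorem sq_dist_concave_segment [CompleteSpace E] [Finite ι] (hν : ∀ i, ‖ν i‖ = 1)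
    (hK : IsCompact (poly ν c)) {z : E} (hz : ∀ i, ⟪ν i, z⟫ < c i) {p : E}
    (hp : p ∈ frontier (poly ν c)) {x₀ h e : E} (he : ‖e‖ = 1) (hhe : ⟪e, h⟫ = 0)
    {F : ℝ → ℝ} {Λ D : ℝ} (hΛ : 0 ≤ Λ)
    (hmem : ∀ τ ∈ Icc (0 : ℝ) 1, x₀ + τ • h + F τ • e ∈ frontier (poly ν c))
    (hbelow : ∀ τ ∈ Icc (0 : ℝ) 1, ∀ t ≤ F τ, x₀ + τ • h + t • e ∈ (interior (poly ν c))ᶜ)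
    (hslope : ∀ τ ∈ Icc (0 : ℝ) 1, ∀ i, ⟪ν i, x₀ + τ • h + F τ • e⟫ = c i →
      ⟪ν i, e⟫ < 0 ∧ |⟪ν i, h⟫| ≤ Λ * ‖h‖ * -⟪ν i, e⟫)
    (hD : ∀ τ ∈ Icc (0 : ℝ) 1,
      JoinedWithin (interior (poly ν c))ᶜ p (x₀ + τ • h + F τ • e) D)
    {τ : ℝ} (hτ : τ ∈ Icc (0 : ℝ) 1) :
    (1 - τ) * (intrinsicDist (interior (poly ν c))ᶜ p (x₀ + F 0 • e) ^ 2 - (2 * D + 1) * F 0) +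
      τ * (intrinsicDist (interior (poly ν c))ᶜ p (x₀ + h + F 1 • e) ^ 2 - (2 * D + 1) * F 1) ≤
    intrinsicDist (interior (poly ν c))ᶜ p (x₀ + τ • h + F τ • e) ^ 2 - (2 * D + 1) * F τ +
      (1 + Λ ^ 2) * ‖h‖ ^ 2 * (τ * (1 - τ)) := by
  have hsub : frontier (poly ν c) ⊆ poly ν c := isClosed_poly.frontier_subset
  have hmem' := fun τ hτ => hsub (hmem τ hτ)
  set S := (interior (poly ν c))ᶜ with hS
  set m : ℝ → E := fun τ => x₀ + τ • h + F τ • e with hm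
  set ρ := intrinsicDist S p with hρ
  have hΛh : 0 ≤ Λ * ‖h‖ := by positivity
  have hhop : ∀ τ ∈ Icc (0 : ℝ) 1, ∀ i, ⟪ν i, m τ⟫ = c i →
      ∃ κ : ℝ, |κ| ≤ Λ * ‖h‖ ∧ ∀ τ' ∈ Icc (0 : ℝ) 1, 0 ≤ F τ' - F τ - (τ' - τ) * κ ∧
      ⟪ν i, m τ + (τ' - τ) • (h + κ • e)⟫ = c i ∧
      JoinedWithin S (m τ + (τ' - τ) • (h + κ • e)) (m τ') (F τ' - F τ - (τ' - τ) * κ) :=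
    fun τ hτ i hi => exists_slope he hmem' hbelow hi (hslope τ hτ i hi)
  have hnorm : ∀ κ : ℝ, ‖h + κ • e‖ ^ 2 = ‖h‖ ^ 2 + κ ^ 2 := by
    intro κ
    rw [norm_add_sq_real, inner_smul_right, real_inner_comm, hhe, norm_smul, he]
    simp
  have hFle : ∀ τ ∈ Icc (0 : ℝ) 1, ∀ τ' ∈ Icc (0 : ℝ) 1,
      F τ - F τ' ≤ Λ * ‖h‖ * |τ' - τ| := by
    intro τ hτ τ' hτ'
    obtain ⟨i, hi⟩ := exists_facet (hmem τ hτ)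
    obtain ⟨κ, hκ, hop⟩ := hhop τ hτ i hi.2
    have h1 := (hop τ' hτ').1
    have h2 : -((τ' - τ) * κ) ≤ |τ' - τ| * |κ| := by
      rw [← abs_mul]
      exact neg_le_abs _
    nlinarith [abs_nonneg (τ' - τ)]
  have hFabs : ∀ τ ∈ Icc (0 : ℝ) 1, ∀ τ' ∈ Icc (0 : ℝ) 1,
      |F τ' - F τ| ≤ Λ * ‖h‖ * |τ' - τ| := by
    intro τ hτ τ' hτ'
    have h1 := hFle τ hτ τ' hτ'
    have h2 := hFle τ' hτ' τ hτ
    rw [abs_sub_comm] at h2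
    exact abs_le.2 ⟨by linarith, h2⟩
  have hδle : ∀ τ ∈ Icc (0 : ℝ) 1, ∀ τ' ∈ Icc (0 : ℝ) 1, ∀ κ : ℝ, |κ| ≤ Λ * ‖h‖ →
      F τ' - F τ - (τ' - τ) * κ ≤ 2 * (Λ * ‖h‖) * |τ' - τ| := by
    intro τ hτ τ' hτ' κ hκ
    have h1 := (le_abs_self _).trans (hFabs τ hτ τ' hτ')
    have h2 : -((τ' - τ) * κ) ≤ |τ' - τ| * |κ| := by
      rw [← abs_mul]
      exact neg_le_abs _
    nlinarith [abs_nonneg (τ' - τ)]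
  have hρle : ∀ τ ∈ Icc (0 : ℝ) 1, ∀ τ' ∈ Icc (0 : ℝ) 1,
      ρ (m τ') - ρ (m τ) ≤ (‖h‖ + 3 * (Λ * ‖h‖)) * |τ' - τ| := by
    intro τ hτ τ' hτ'
    obtain ⟨i, hi⟩ := exists_facet (hmem τ hτ)
    obtain ⟨κ, hκ, hop⟩ := hhop τ hτ i hi.2
    obtain ⟨h1, h2, h3⟩ := hop τ' hτ'
    have h4 := (hD τ hτ).intrinsicDist_le_add ((joinedWithin_hyperplane hν hi.2 h2).trans h3)
    have h5 : ‖m τ - (m τ + (τ' - τ) • (h + κ • e))‖ ≤ |τ' - τ| * (‖h‖ + Λ * ‖h‖) := by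
      rw [sub_add_cancel_left, norm_neg, norm_smul, Real.norm_eq_abs]
      gcongr
      refine (norm_add_le _ _).trans ?_
      rw [norm_smul, he, mul_one, Real.norm_eq_abs]
      gcongr
    have h6 := hδle τ hτ τ' hτ' κ hκ
    have h7 : ρ (m τ') ≤ ρ (m τ) + _ := h4
    simp only [hm] at h5 h7 ⊢
    linarith
  have hρc : ContinuousOn (fun τ => ρ (m τ)) (Icc 0 1) := by
    have : LipschitzOnWith (Real.toNNReal (‖h‖ + 3 * (Λ * ‖h‖))) (fun τ => ρ (m τ)) (Icc 0 1) := by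
      refine LipschitzOnWith.of_dist_le_mul fun a ha b hb => ?_
      rw [Real.dist_eq, Real.dist_eq, Real.coe_toNNReal _ (by positivity)]
      have h1 := hρle a ha b hb
      have h2 := hρle b hb a ha
      rw [abs_sub_comm] at h1
      exact abs_le.2 ⟨by linarith, h2⟩
    exact this.continuousOn
  have hFc : ContinuousOn F (Icc 0 1) := by
    have : LipschitzOnWith (Real.toNNReal (Λ * ‖h‖)) F (Icc 0 1) := by
      refine LipschitzOnWith.of_dist_le_mul fun a ha b hb => ?_
      rw [Real.dist_eq, Real.dist_eq, Real.coe_toNNReal _ (by positivity)]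
      exact hFabs b hb a ha
    exact this.continuousOn
  have key := le_of_locally_concave
    (G := fun τ => ρ (m τ) ^ 2 - (2 * D + 1) * F τ - (1 + Λ ^ 2) * ‖h‖ ^ 2 * τ ^ 2)
    (((hρc.pow 2).sub (continuousOn_const.mul hFc)).sub (by fun_prop)) ?_ hτ
  · have e0 : m 0 = x₀ + F 0 • e := by simp [hm]
    have e1 : m 1 = x₀ + h + F 1 • e := by simp [hm]
    simp only [e0, e1] at key
    simp only [hm] at key
    linarith
  clear hτ τ
  intro τ hτ
  have hτ' := Ioo_subset_Icc_self hτ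
  obtain ⟨i, P, hi, hP, hPρ, -, ε, hε, hloc⟩ :=
    unfoldsAt_of_mem_frontier hν hK hz hp (hmem τ hτ') (hD τ hτ')
  change ‖P - m τ‖ = ρ (m τ) at hPρ
  obtain ⟨κ, hκ, hop⟩ := hhop τ hτ' i hi.2
  set v := h + κ • e with hv
  have hvn : 0 ≤ ‖v‖ := norm_nonneg v
  have hq : 0 < 2 * ‖v‖ + 2 * (Λ * ‖h‖) + 1 := by positivity
  refine ⟨min (min τ (1 - τ)) (min (ε / (‖v‖ + 1)) (1 / (2 * ‖v‖ + 2 * (Λ * ‖h‖) + 1))),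
    lt_min (lt_min hτ.1 (sub_pos.2 hτ.2)) (lt_min (by positivity) (by positivity)), fun s hs => ?_⟩
  obtain ⟨hs0, hs1⟩ := hs
  rw [lt_min_iff, lt_min_iff, lt_min_iff, lt_div_iff₀ (by positivity), lt_div_iff₀ hq] at hs1
  obtain ⟨⟨hs1, hs2⟩, hs3, hs4⟩ := hs1
  have hρD : ρ (m τ) ≤ D := (hD τ hτ').intrinsicDist_le
  have side : ∀ u : ℝ, |u| = s → τ + u ∈ Icc (0 : ℝ) 1 →
      ρ (m (τ + u)) ^ 2 ≤ ‖P - (m τ + u • v)‖ ^ 2 + (2 * D + 1) * (F (τ + u) - F τ - u * κ) := by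
    intro u hu hmu
    obtain ⟨h1, h2, h3⟩ := hop _ hmu
    rw [add_sub_cancel_left] at h1 h2 h3
    have hnu : ‖m τ + u • v - m τ‖ = s * ‖v‖ := by
      rw [add_sub_cancel_left, norm_smul, Real.norm_eq_abs, hu]
    have h4 : ρ (m τ + u • v) ≤ ‖P - (m τ + u • v)‖ := hloc _ h2 (by
      change ‖m τ + u • v - m τ‖ < ε
      rw [hnu]
      nlinarith)
    have h5 : ρ (m (τ + u)) ≤ ρ (m τ + u • v) + (F (τ + u) - F τ - u * κ) :=
      ((hD τ hτ').trans (joinedWithin_hyperplane hν hi.2 h2)).intrinsicDist_le_add h3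
    have h6 : ‖P - (m τ + u • v)‖ ≤ D + s * ‖v‖ := by
      have := norm_sub_le_norm_sub_add_norm_sub P (m τ) (m τ + u • v)
      rw [norm_sub_rev (m τ), hnu, hPρ] at this
      linarith
    have h7 := hδle τ hτ' _ hmu κ hκ
    rw [add_sub_cancel_left, hu] at h7
    set δ := F (τ + u) - F τ - u * κ
    set r := ‖P - (m τ + u • v)‖
    have h8 : ρ (m (τ + u)) ≤ r + δ := by linarith
    have h9 : 0 ≤ ρ (m (τ + u)) := intrinsicDist_nonneg _ _ _
    have h10 : ρ (m (τ + u)) ^ 2 ≤ (r + δ) ^ 2 := pow_le_pow_left₀ h9 h8 2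
    have h11 : (2 * r + δ) * δ ≤ (2 * D + 1) * δ := by
      refine mul_le_mul_of_nonneg_right ?_ h1
      nlinarith
    nlinarith
  have hp1 := side s (abs_of_pos hs0) ⟨by linarith, by linarith⟩
  have hp2 := side (-s) (by rw [abs_neg, abs_of_pos hs0]) ⟨by linarith, by linarith⟩
  rw [← sub_eq_add_neg] at hp2
  have hpar := parallelogram_law_with_norm ℝ (P - m τ) (s • v)
  have e1 : P - m τ + s • v = P - (m τ + (-s) • v) := by module
  have e2 : P - m τ - s • v = P - (m τ + s • v) := by module
  rw [e1, e2, hPρ, norm_smul, Real.norm_of_nonneg hs0.le] at hpar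
  have hκ2 : κ ^ 2 ≤ (Λ * ‖h‖) ^ 2 := sq_le_sq' (by linarith [(abs_le.1 hκ).1]) (abs_le.1 hκ).2
  have hv2 : s ^ 2 * ‖v‖ ^ 2 ≤ s ^ 2 * ((1 + Λ ^ 2) * ‖h‖ ^ 2) := by
    refine mul_le_mul_of_nonneg_left ?_ (by positivity)
    rw [hnorm]
    nlinarith
  nlinarith

end Segment

/-! ### Polyhedral approximation of a convex body -/

section Approx

universe u

variable {E : Type u} [NormedAddCommGroup E] [InnerProductSpace ℝ E]

lemma exists_mem_frontier_segment {C : Set E} (hC : IsClosed C) {a b : E} (ha : a ∈ C)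
    (hb : b ∉ interior C) : ∃ θ ∈ Icc (0 : ℝ) 1, a + θ • (b - a) ∈ frontier C := by
  by_contra! hcon
  have hseg : segment ℝ a b ⊆ interior C ∪ Cᶜ := by
    rw [segment_eq_image']
    rintro _ ⟨θ, hθ, rfl⟩
    by_cases h : a + θ • (b - a) ∈ C
    · exact Or.inl (by
        by_contra h'
        exact hcon θ hθ (hC.frontier_eq ▸ ⟨h, h'⟩))
    · exact Or.inr h
  have ha' : a ∈ interior C := (hseg (left_mem_segment ℝ a b)).resolve_right (fun h => h ha)
  have hb' : b ∈ Cᶜ := (hseg (right_mem_segment ℝ a b)).resolve_left hb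
  obtain ⟨y, -, hy1, hy2⟩ := (convex_segment (𝕜 := ℝ) a b).isPreconnected _ _ isOpen_interior
    hC.isOpen_compl hseg ⟨a, left_mem_segment ℝ a b, ha'⟩ ⟨b, right_mem_segment ℝ a b, hb'⟩
  exact hy2 (interior_subset hy1)

lemma homothety_mem_interior {K C : Set E} {z : E} {r : ℝ} (hr : r ≠ 0)
    (h : ∀ x ∈ K, z + r • (x - z) ∈ C) {x : E} (hx : x ∈ interior K) :
    z + r • (x - z) ∈ interior C := by
  have hopen := AffineMap.homothety_isOpenMap (R := ℝ) z r hr _ (isOpen_interior (s := K))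
  refine interior_maximal ?_ hopen ⟨x, hx, ?_⟩
  · rintro _ ⟨y, hy, rfl⟩
    have := h y (interior_subset hy)
    rwa [AffineMap.homothety_apply, vsub_eq_sub, vadd_eq_add, add_comm]
  · rw [AffineMap.homothety_apply, vsub_eq_sub, vadd_eq_add, add_comm]

lemma exists_halfspace [CompleteSpace E] {C : Set E} (hC : IsClosed C) (hconv : Convex ℝ C)
    (hne : C.Nonempty) {y : E} (hy : y ∉ C) :
    ∃ ν : E, ∃ c : ℝ, ‖ν‖ = 1 ∧ (∀ x ∈ C, ⟪ν, x⟫ ≤ c) ∧ c < ⟪ν, y⟫ := by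
  obtain ⟨q, hq, hqmin⟩ := exists_norm_eq_iInf_of_complete_convex hne hC.isComplete hconv y
  have hle := (norm_eq_iInf_iff_real_inner_le_zero hconv hq).1 hqmin
  have hyq : y - q ≠ 0 := sub_ne_zero.2 (by rintro rfl; exact hy hq)
  have hpos : 0 < ‖y - q‖ := norm_pos_iff.2 hyq
  refine ⟨‖y - q‖⁻¹ • (y - q), ⟪‖y - q‖⁻¹ • (y - q), q⟫, ?_, fun x hx => ?_, ?_⟩
  · rw [norm_smul, norm_inv, norm_norm, inv_mul_cancel₀ hpos.ne']
  · have := hle x hx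
    rw [← sub_nonpos, ← inner_sub_right, real_inner_smul_left]
    exact mul_nonpos_of_nonneg_of_nonpos (by positivity) this
  · rw [← sub_pos, ← inner_sub_right, real_inner_smul_left, real_inner_self_eq_norm_sq]
    positivity

lemma exists_poly_approx [FiniteDimensional ℝ E] {C : Set E} (hC : IsCompact C)
    (hconv : Convex ℝ C) {z : E} (hz : z ∈ interior C) {ε : ℝ} (hε : 0 < ε) :
    ∃ (ι : Type u) (_ : Finite ι) (ν : ι → E) (c : ι → ℝ), (∀ i, ‖ν i‖ = 1) ∧
      C ⊆ poly ν c ∧ IsCompact (poly ν c) ∧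
      ∀ x ∈ poly ν c, z + (1 + ε)⁻¹ • (x - z) ∈ C := by
  have hzC := interior_subset hz
  have hfr : IsCompact (frontier C) := hC.of_isClosed_subset isClosed_frontier
    hC.isClosed.frontier_subset
  have hex : ∀ x : frontier C, ∃ ν : E, ∃ c : ℝ, ‖ν‖ = 1 ∧ (∀ y ∈ C, ⟪ν, y⟫ ≤ c) ∧
      c < ⟪ν, z + (1 + ε) • ((x : E) - z)⟫ := by
    rintro ⟨x, hx⟩
    refine exists_halfspace hC.isClosed hconv ⟨z, hzC⟩ fun hy => ?_
    rw [hC.isClosed.frontier_eq] at hx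
    refine hx.2 ?_
    have h1 : (1 + ε)⁻¹ * (1 + ε) = 1 := inv_mul_cancel₀ (by positivity)
    have h2 : (1 + ε)⁻¹ < 1 := inv_lt_one_of_one_lt₀ (by linarith)
    have := hconv.combo_interior_self_mem_interior hz hy (a := 1 - (1 + ε)⁻¹) (b := (1 + ε)⁻¹)
      (by linarith) (by positivity) (by ring)
    convert this using 1
    rw [smul_add, smul_smul, h1]
    module
  choose ν c hν hle hlt using hex
  obtain ⟨t, ht⟩ := hfr.elim_finite_subcover
    (fun i : frontier C => {x : E | c i < ⟪ν i, z + (1 + ε) • (x - z)⟫})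
    (fun i => isOpen_lt continuous_const (by fun_prop))
    (fun x hx => mem_iUnion.2 ⟨⟨x, hx⟩, hlt ⟨x, hx⟩⟩)
  have hsub : C ⊆ poly (fun i : t => ν i) (fun i : t => c i) := fun x hx i => hle i x hx
  have hscale : ∀ x ∈ poly (fun i : t => ν i) (fun i : t => c i),
      z + (1 + ε)⁻¹ • (x - z) ∈ C := by
    intro x hx
    by_contra hw
    obtain ⟨θ, hθ, hfθ⟩ := exists_mem_frontier_segment hC.isClosed hzC
      (fun h => hw (interior_subset h))
    obtain ⟨i, hi, hci⟩ := mem_iUnion₂.1 (ht hfθ)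
    have h1 : (1 + ε) * θ * (1 + ε)⁻¹ = θ := by field_simp
    have e1 : z + (1 + ε) • (z + θ • (z + (1 + ε)⁻¹ • (x - z) - z) - z) = z + θ • (x - z) := by
      rw [add_sub_cancel_left, add_sub_cancel_left, smul_smul, smul_smul, h1]
    have h2 := convex_poly.add_smul_sub_mem (hsub hzC) hx hθ ⟨i, hi⟩
    change c i < ⟪ν i, _⟫ at hci
    rw [e1] at hci
    exact absurd h2 (not_le.2 hci)
  refine ⟨t, inferInstance, fun i => ν i, fun i => c i, fun i => hν i, hsub, ?_, hscale⟩
  refine (hC.image (f := fun y : E => z + (1 + ε) • (y - z)) (by fun_prop)).of_isClosed_subset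
    isClosed_poly fun x hx => ⟨_, hscale x hx, ?_⟩
  have h1 : (1 + ε) * (1 + ε)⁻¹ = 1 := mul_inv_cancel₀ (by positivity)
  simp only [add_sub_cancel_left, smul_smul, h1, one_smul, add_sub_cancel]

/-! ### Vertical lines -/

lemma exists_lowest {K : Set E} (hK : IsCompact K) {e x : E} (he : ‖e‖ = 1) (hx : ⟪e, x⟫ = 0)
    {t : ℝ} (ht : x + t • e ∈ K) : ∃ s : ℝ, x + s • e ∈ K ∧ ∀ t, x + t • e ∈ K → s ≤ t := by
  have hee : ⟪e, e⟫ = 1 := by rw [real_inner_self_eq_norm_sq, he]; norm_num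
  have hval : ∀ t : ℝ, ⟪e, x + t • e⟫ = t := fun t => by
    rw [inner_add_right, inner_smul_right, hx, hee]; ring
  have hcl : IsClosed {y : E | y - ⟪e, y⟫ • e = x} := isClosed_eq (by fun_prop) continuous_const
  have hmem : ∀ t : ℝ, x + t • e ∈ {y : E | y - ⟪e, y⟫ • e = x} := fun t => by
    rw [mem_ofPred_eq, hval, add_sub_cancel_right]
  obtain ⟨y, hy, hmin⟩ := (hK.inter_right hcl).exists_isMinOn ⟨_, ht, hmem t⟩
    (f := fun y => ⟪e, y⟫) (by fun_prop)
  refine ⟨⟪e, y⟫, ?_, fun t ht => ?_⟩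
  · have : x + ⟪e, y⟫ • e = y := (sub_eq_iff_eq_add.1 hy.2).symm
    rw [this]
    exact hy.1
  · have := hmin ⟨ht, hmem t⟩
    change ⟪e, y⟫ ≤ ⟪e, x + t • e⟫ at this
    rwa [hval] at this

lemma notMem_interior_of_below {K : Set E} {x e : E} {s : ℝ} (h : ∀ t < s, x + t • e ∉ K)
    {t : ℝ} (ht : t ≤ s) : x + t • e ∉ interior K := by
  intro hint
  have hc : ContinuousAt (fun r : ℝ => x + r • e) t := by fun_prop
  obtain ⟨δ, hδ, hball⟩ := Metric.eventually_nhds_iff.1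
    (hc.eventually (isOpen_interior.mem_nhds hint))
  refine h (t - δ / 2) (by linarith) (interior_subset (hball ?_))
  rw [Real.dist_eq, sub_sub_cancel_left, abs_neg, abs_of_pos (by positivity)]
  linarith

lemma joinedWithin_vertical {K : Set E} {x e : E} (he : ‖e‖ = 1) {s : ℝ}
    (h : ∀ t < s, x + t • e ∉ K) {t t' : ℝ} (htt : t ≤ t') (ht' : t' ≤ s) :
    JoinedWithin (interior K)ᶜ (x + t • e) (x + t' • e) (t' - t) := by
  have h1 := joinedWithin_segment (S := (interior K)ᶜ) (x := x + t • e) (y := x + t' • e) (by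
    rw [segment_eq_image']
    rintro _ ⟨θ, hθ, rfl⟩
    have : x + t • e + θ • (x + t' • e - (x + t • e)) = x + (t + θ * (t' - t)) • e := by module
    beta_reduce
    rw [this]
    exact notMem_interior_of_below h (by nlinarith [hθ.1, hθ.2]))
  refine h1.mono subset_rfl (le_of_eq ?_)
  have : x + t • e - (x + t' • e) = (-(t' - t)) • e := by module
  rw [this, norm_smul, he, mul_one, norm_neg, Real.norm_of_nonneg (by linarith)]

lemma joinedWithin_ray {C : Set E} (hconv : Convex ℝ C) {z p : E} (hz : z ∈ interior C) {s t : ℝ}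
    (hs : 0 < s) (hst : s ≤ t) (hp : z + s • (p - z) ∉ interior C) :
    JoinedWithin (interior C)ᶜ (z + s • (p - z)) (z + t • (p - z)) ((t - s) * ‖p - z‖) := by
  have h := joinedWithin_radial hconv hz hp (s := t / s) ((one_le_div hs).2 hst)
  have h1 : t / s * s = t := div_mul_cancel₀ _ hs.ne'
  rw [add_sub_cancel_left, smul_smul, h1, norm_smul, Real.norm_of_nonneg hs.le, ← mul_assoc,
    sub_mul, h1, one_mul] at h
  exact h

end Approx

/-! ### Lower graphs in the boundary of a convex body -/

section Graph

universe u

variable {E : Type u} [NormedAddCommGroup E] [InnerProductSpace ℝ E]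

/-- The graph of the `L`-Lipschitz function `f` over the convex set `V ⊆ eᗮ` is part of the lower
boundary of `C` in the direction `e`. -/
structure IsLowerGraph (C : Set E) (e : E) (V : Set E) (f : E → ℝ) (L : ℝ) : Prop where
  norm_eq : ‖e‖ = 1
  orth : ∀ x ∈ V, ⟪e, x⟫ = 0
  convex : Convex ℝ V
  nonneg : 0 ≤ L
  lip : ∀ x ∈ V, ∀ y ∈ V, f x ≤ f y + L * ‖x - y‖
  mem : ∀ x ∈ V, x + f x • e ∈ C
  below : ∀ x ∈ V, ∀ t < f x, x + t • e ∉ C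
  above : ∀ x ∈ V, ∃ t > f x, x + t • e ∈ interior C

variable {C : Set E} {e : E} {V : Set E} {f : E → ℝ} {L : ℝ}

lemma norm_horizontal_le (he : ‖e‖ = 1) (w : E) : ‖w - ⟪e, w⟫ • e‖ ≤ ‖w‖ := by
  have h : ‖w - ⟪e, w⟫ • e‖ ^ 2 = ‖w‖ ^ 2 - ⟪e, w⟫ ^ 2 := by
    rw [norm_sub_sq_real, inner_smul_right, norm_smul, he, real_inner_comm, mul_one,
      Real.norm_eq_abs, sq_abs]
    ring
  refine le_of_sq_le_sq ?_ (norm_nonneg _)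
  rw [h]
  linarith [sq_nonneg ⟪e, w⟫]

lemma IsLowerGraph.sub_le_height (hG : IsLowerGraph C e V f L) {x : E} (hx : x ∈ V) {r : ℝ}
    (hball : ∀ u, ⟪e, u⟫ = 0 → ‖u‖ ≤ r → x + u ∈ V) {s : ℝ} {y : E} (hy : y ∈ C)
    (hys : ‖y - (x + s • e)‖ ≤ r) : f x - (L + 1) * r ≤ s := by
  have he := hG.norm_eq
  have hee : ⟪e, e⟫ = 1 := by rw [real_inner_self_eq_norm_sq, he]; norm_num
  set w := y - (x + s • e) with hw
  have hyw : y = x + (w - ⟪e, w⟫ • e) + (s + ⟪e, w⟫) • e := by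
    rw [hw]
    module
  have hu : ⟪e, w - ⟪e, w⟫ • e⟫ = 0 := by
    rw [inner_sub_right, inner_smul_right, hee]
    ring
  have hun := (norm_horizontal_le he w).trans hys
  have hV := hball _ hu hun
  have h1 : f (x + (w - ⟪e, w⟫ • e)) ≤ s + ⟪e, w⟫ := by
    by_contra! hcon
    exact hG.below _ hV _ hcon (hyw ▸ hy)
  have h2 := hG.lip x hx _ hV
  rw [sub_add_cancel_left, norm_neg] at h2
  have h3 : ⟪e, w⟫ ≤ r := by
    have := (real_inner_le_norm e w).trans_eq (by rw [he, one_mul])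
    exact this.trans hys
  have h4 := mul_le_mul_of_nonneg_left hun hG.nonneg
  linarith

lemma IsLowerGraph.slope (hG : IsLowerGraph C e V f L) {ι : Type*} {ν : ι → E} {c : ι → ℝ}
    (hν : ∀ i, ‖ν i‖ = 1) (hCK : C ⊆ poly ν c) {x : E} (hx : x ∈ V) {δ : ℝ} (hδ : 0 < δ)
    (hball : ∀ u, ⟪e, u⟫ = 0 → ‖u‖ ≤ δ → x + u ∈ V) {s : ℝ} (hs : s ≤ f x)
    (hs' : f x - δ ≤ s) {i : ι} (hi : ⟪ν i, x + s • e⟫ = c i) {h : E} (hh : ⟪e, h⟫ = 0) :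
    ⟪ν i, e⟫ < 0 ∧ |⟪ν i, h⟫| ≤ (L + 1) * ‖h‖ * -⟪ν i, e⟫ := by
  have hneg : ⟪ν i, e⟫ < 0 := by
    obtain ⟨t, ht, htC⟩ := hG.above x hx
    have h1 := lt_of_mem_interior_poly hν (interior_mono hCK htC) i
    rw [← hi, inner_add_right, inner_add_right, inner_smul_right, inner_smul_right] at h1
    nlinarith
  refine ⟨hneg, ?_⟩
  have key : ∀ h : E, ⟪e, h⟫ = 0 → ⟪ν i, h⟫ ≤ (L + 1) * ‖h‖ * -⟪ν i, e⟫ := by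
    intro h hh
    rcases eq_or_ne h 0 with rfl | h0
    · simp
    have hpos : 0 < ‖h‖ := norm_pos_iff.2 h0
    have hn : ‖(δ / ‖h‖) • h‖ = δ := by
      rw [norm_smul, Real.norm_of_nonneg (by positivity), div_mul_cancel₀ _ hpos.ne']
    have hV := hball ((δ / ‖h‖) • h) (by rw [inner_smul_right, hh, mul_zero]) hn.le
    have h1 := hCK (hG.mem _ hV) i
    have h2 := hG.lip _ hV x hx
    rw [add_sub_cancel_left, hn] at h2
    rw [← hi, inner_add_right, inner_add_right, inner_add_right, inner_smul_right,
      inner_smul_right, inner_smul_right] at h1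
    have h3 : δ / ‖h‖ * ⟪ν i, h⟫ ≤ (L + 1) * δ * -⟪ν i, e⟫ := by nlinarith
    rw [div_mul_eq_mul_div, div_le_iff₀ hpos] at h3
    have h4 : δ * ⟪ν i, h⟫ ≤ δ * ((L + 1) * ‖h‖ * -⟪ν i, e⟫) := by linarith
    exact le_of_mul_le_mul_left h4 hδ
  refine abs_le.2 ⟨?_, key h hh⟩
  have := key (-h) (by rw [inner_neg_right, hh, neg_zero])
  rw [inner_neg_right, norm_neg] at this
  linarith

lemma JoinedWithin.scale {K : Set E} (hK : Convex ℝ K) {z : E} (hz : z ∈ interior K) {ε : ℝ}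
    (hε : 0 < ε) (hscale : ∀ x ∈ K, z + (1 + ε)⁻¹ • (x - z) ∈ C) {p q : E} {l : ℝ}
    (h : JoinedWithin (interior C)ᶜ p q l) {s : ℝ} (hs : 0 < s) (hs' : s ≤ 1 + ε)
    (hp : z + s • (p - z) ∉ interior K) :
    JoinedWithin (interior K)ᶜ (z + s • (p - z)) (z + (1 + ε) • (q - z))
      ((1 + ε - s) * ‖p - z‖ + (1 + ε) * l) := by
  have hinv : (1 + ε)⁻¹ * (1 + ε) = 1 := inv_mul_cancel₀ (by positivity)
  have hmap : MapsTo (fun y : E => z + (1 + ε) • (y - z)) (interior C)ᶜ (interior K)ᶜ := by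
    intro y hy hy'
    refine hy ?_
    have := homothety_mem_interior (by positivity) hscale hy'
    rwa [add_sub_cancel_left, smul_smul, hinv, one_smul, add_sub_cancel] at this
  have hlip : LipschitzOnWith (Real.toNNReal (1 + ε)) (fun y : E => z + (1 + ε) • (y - z))
      (interior C)ᶜ := by
    refine LipschitzOnWith.of_dist_le_mul fun a _ b _ => le_of_eq ?_
    rw [Real.coe_toNNReal _ (by positivity), dist_eq_norm, dist_eq_norm]
    have : z + (1 + ε) • (a - z) - (z + (1 + ε) • (b - z)) = (1 + ε) • (a - b) := by module
    rw [this, norm_smul, Real.norm_of_nonneg (by positivity)]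
  have h1 := h.map hlip hmap
  rw [Real.coe_toNNReal _ (by positivity)] at h1
  exact (joinedWithin_ray hK hz hs hs' hp).trans h1

end Graph

section Limit

universe u

variable {E : Type u} [NormedAddCommGroup E] [InnerProductSpace ℝ E]
  {C : Set E} {e : E} {V : Set E} {f : E → ℝ} {L : ℝ}

set_option maxHeartbeats 1000000 in
/-- The concavity estimate with an error term, obtained from a polyhedron at distance of
order `ε` from `C`. -/
lemma IsLowerGraph.approx_concave [FiniteDimensional ℝ E]
    (hdim : ∀ u : E, ∃ w : E, ‖w‖ = 1 ∧ ⟪u, w⟫ = 0) (hC : IsCompact C) (hconv : Convex ℝ C)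
    {R : ℝ} (hR : 0 < R) (hCR : C ⊆ Metric.closedBall 0 R) (hG : IsLowerGraph C e V f L)
    {p : E} (hp : p ∈ frontier C) {a b : E} (ha : a ∈ V) (hb : b ∈ V) {δ : ℝ} (hδ : 0 < δ)
    (hball : ∀ τ ∈ Icc (0 : ℝ) 1, ∀ u, ⟪e, u⟫ = 0 → ‖u‖ ≤ δ → a + τ • (b - a) + u ∈ V)
    {τ : ℝ} (hτ : τ ∈ Icc (0 : ℝ) 1) {t₀ : ℝ}
    (hz : a + τ • (b - a) + t₀ • e ∈ interior C) {ε : ℝ} (hε : 0 < ε) (hε1 : ε ≤ 1)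
    (hεδ : (L + 1) * (2 * R * ε) ≤ δ) :
    (1 - τ) * (intrinsicDist (interior C)ᶜ p (a + f a • e) ^ 2 - (2 * (24 * R) + 1) * f a) +
      τ * (intrinsicDist (interior C)ᶜ p (b + f b • e) ^ 2 - (2 * (24 * R) + 1) * f b) ≤
    ((1 + ε) * intrinsicDist (interior C)ᶜ p
        (a + τ • (b - a) + f (a + τ • (b - a)) • e) + 4 * R * ε) ^ 2 -
      (2 * (24 * R) + 1) * f (a + τ • (b - a)) +
      (1 + (L + 1) ^ 2) * ‖b - a‖ ^ 2 * (τ * (1 - τ)) +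
      ((2 * (24 * R) + 1) * ((L + 1) * (2 * R * ε)) +
        2 * (24 * R) * (2 * R * ε + (L + 1) * (2 * R * ε)) +
        (2 * R * ε + (L + 1) * (2 * R * ε)) ^ 2) := by
  have he := hG.norm_eq
  have hL := hG.nonneg
  set x := a + τ • (b - a) with hx
  set z := x + t₀ • e with hzdef
  set η := (L + 1) * (2 * R * ε) with hη
  have hRε : 0 < 2 * R * ε := by positivity
  have hη0 : 2 * R * ε ≤ η := by nlinarith
  have hline : ∀ τ ∈ Icc (0 : ℝ) 1, a + τ • (b - a) ∈ V := fun τ hτ => by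
    simpa using hball τ hτ 0 (by simp) (by simpa using hδ.le)
  have hxV : x ∈ V := hline τ hτ
  have hnorm : ∀ y ∈ C, ‖y‖ ≤ R := fun y hy => by simpa using hCR hy
  have hzC := interior_subset hz
  have hzn : ∀ y ∈ C, ‖y - z‖ ≤ 2 * R := fun y hy => by
    linarith [norm_sub_le y z, hnorm y hy, hnorm z hzC]
  obtain ⟨ι, _, ν, c, hν, hCK, hK, hscale⟩ := exists_poly_approx hC hconv hz hε
  have hzK := interior_mono hCK hz
  have hdiff : ∀ y ∈ poly ν c, ‖z + (1 + ε)⁻¹ • (y - z) - y‖ ≤ 2 * R * ε ∧ ‖y - z‖ ≤ 4 * R := by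
    intro y hy
    have h1 := hzn _ (hscale y hy)
    set w := z + (1 + ε)⁻¹ • (y - z) - z with hw
    have hyw : y - z = (1 + ε) • w := by
      rw [hw, add_sub_cancel_left, smul_smul, mul_inv_cancel₀ (by positivity), one_smul]
    have hyw' : z + (1 + ε)⁻¹ • (y - z) - y = (-ε) • w := by
      have : z + (1 + ε)⁻¹ • (y - z) - y = w - (y - z) := by rw [hw]; module
      rw [this, hyw]
      module
    rw [hyw', hyw, norm_smul, norm_smul, norm_neg, Real.norm_of_nonneg hε.le,
      Real.norm_of_nonneg (by positivity)]
    constructor <;> nlinarith [norm_nonneg w]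
  have hlow : ∀ y, ∃ s : ℝ, y ∈ V →
      y + s • e ∈ poly ν c ∧ ∀ t, y + t • e ∈ poly ν c → s ≤ t := by
    intro y
    by_cases hy : y ∈ V
    · obtain ⟨s, hs⟩ := exists_lowest hK he (hG.orth y hy) (hCK (hG.mem y hy))
      exact ⟨s, fun _ => hs⟩
    · exact ⟨0, fun h => absurd h hy⟩
  choose FK hFK using hlow
  have hFKle : ∀ y ∈ V, FK y ≤ f y := fun y hy => (hFK y hy).2 _ (hCK (hG.mem y hy))
  have hFKbelow : ∀ y ∈ V, ∀ t < FK y, y + t • e ∉ poly ν c := fun y hy t ht h =>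
    not_lt.2 ((hFK y hy).2 t h) ht
  have hFKfr : ∀ y ∈ V, y + FK y • e ∈ frontier (poly ν c) := fun y hy => by
    rw [isClosed_poly.frontier_eq]
    exact ⟨(hFK y hy).1, notMem_interior_of_below (hFKbelow y hy) le_rfl⟩
  have hFKge : ∀ τ ∈ Icc (0 : ℝ) 1, f (a + τ • (b - a)) - η ≤ FK (a + τ • (b - a)) := by
    intro τ hτ
    have hy := hline τ hτ
    have hyK := (hFK _ hy).1
    exact hG.sub_le_height hy (fun u hu hun => hball τ hτ u hu (by linarith)) (hscale _ hyK)
      (hdiff _ hyK).1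
  have hpC : p ∈ C := hC.isClosed.frontier_subset hp
  have hpint : p ∉ interior C := (hC.isClosed.frontier_eq ▸ hp).2
  have hout : ∀ {y : E}, y ∉ interior C → z + (1 + ε) • (y - z) ∉ interior (poly ν c) := by
    intro y hy hy'
    have := homothety_mem_interior (by positivity) hscale hy'
    rw [add_sub_cancel_left, smul_smul, inv_mul_cancel₀ (by positivity), one_smul,
      add_sub_cancel] at this
    exact hy this
  obtain ⟨θ, hθ, hpK⟩ := exists_mem_frontier_segment isClosed_poly (hCK hpC) (hout hpint)
  have hpe : p + θ • (z + (1 + ε) • (p - z) - p) = z + (1 + θ * ε) • (p - z) := by module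
  rw [hpe] at hpK
  have hθε : 0 ≤ θ * ε := mul_nonneg hθ.1 hε.le
  have hθε' : θ * ε ≤ ε := by nlinarith [hθ.2]
  set pK := z + (1 + θ * ε) • (p - z) with hpKdef
  have hpKint : pK ∉ interior (poly ν c) := hpK.2
  have hD : ∀ y ∈ V, JoinedWithin (interior (poly ν c))ᶜ pK (y + FK y • e) (24 * R) := by
    intro y hy
    have := joinedWithin_outside hdim convex_poly hzK (R := 4 * R) (by positivity)
      (fun y hy => by simpa [dist_eq_norm] using (hdiff y hy).2) hpKint
      (notMem_interior_of_below (hFKbelow y hy) le_rfl)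
      (hdiff _ (isClosed_poly.frontier_subset hpK)).2 (hdiff _ (hFK y hy).1).2
    exact this.mono subset_rfl (by linarith)
  have horth : ⟪e, b - a⟫ = 0 := by rw [inner_sub_right, hG.orth a ha, hG.orth b hb, sub_zero]
  have hconc := sq_dist_concave_segment hν hK (fun i => lt_of_mem_interior_poly hν hzK i) hpK
    (x₀ := a) (h := b - a) he horth (F := fun τ => FK (a + τ • (b - a))) (Λ := L + 1)
    (by linarith) (fun τ hτ => hFKfr _ (hline τ hτ))
    (fun τ hτ t ht => notMem_interior_of_below (hFKbelow _ (hline τ hτ)) ht)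
    (fun τ hτ i hi => hG.slope hν hCK (hline τ hτ) hδ (hball τ hτ) (hFKle _ (hline τ hτ))
      (by linarith [hFKge τ hτ]) hi horth)
    (fun τ hτ => hD _ (hline τ hτ)) hτ
  simp only [zero_smul, add_zero, one_smul, add_sub_cancel, ← hx] at hconc
  set ρ := intrinsicDist (interior C)ᶜ p with hρ
  set ρK := intrinsicDist (interior (poly ν c))ᶜ pK with hρK
  have hsub : (interior (poly ν c))ᶜ ⊆ (interior C)ᶜ := compl_subset_compl.2 (interior_mono hCK)
  have hpz : ‖p - z‖ ≤ 2 * R := hzn p hpC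
  have lower : ∀ y ∈ V, f y - η ≤ FK y → ρ (y + f y • e) ^ 2 - (2 * (24 * R) + 1) * f y ≤
      ρK (y + FK y • e) ^ 2 - (2 * (24 * R) + 1) * FK y +
        (2 * (24 * R) * (2 * R * ε + η) + (2 * R * ε + η) ^ 2) := by
    intro y hy hge
    have h1 := joinedWithin_ray hconv hz (p := p) (s := 1) (t := 1 + θ * ε) one_pos (by linarith)
      (by simpa using hpint)
    rw [one_smul, add_sub_cancel, ← hpKdef] at h1
    have h2 := joinedWithin_vertical he (hG.below y hy) (hFKle y hy) le_rfl
    have h3 : ρ (y + f y • e) ≤ ρK (y + FK y • e) + (2 * R * ε + η) := by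
      refine le_of_forall_pos_le_add fun r hr => ?_
      have := ((h1.trans (((hD y hy).add_eps hr).mono hsub le_rfl)).trans h2).intrinsicDist_le
      rw [← hρ, ← hρK] at this
      nlinarith
    have h4 : ρK (y + FK y • e) ≤ 24 * R := (hD y hy).intrinsicDist_le
    have h5 : 0 ≤ ρ (y + f y • e) := intrinsicDist_nonneg _ _ _
    have h6 := pow_le_pow_left₀ h5 h3 2
    have h7 := hFKle y hy
    have h8 : 0 ≤ 2 * R * ε + η := by linarith
    nlinarith
  have upper : ρK (x + FK x • e) ≤ (1 + ε) * ρ (x + f x • e) + 4 * R * ε := by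
    have hxC := hG.mem x hxV
    have hxint := notMem_interior_of_below (hG.below x hxV) le_rfl
    have hj := joinedWithin_outside hdim hconv hz (R := 2 * R) (by positivity)
      (fun y hy => by simpa [dist_eq_norm] using hzn y hy) hpint hxint hpz (hzn _ hxC)
    have hq : z + (1 + ε) • (x + f x • e - z) = x + (t₀ + (1 + ε) * (f x - t₀)) • e := by
      rw [hzdef]
      module
    have hxt : t₀ - f x ≤ 2 * R := by
      have h1 := hzn _ hxC
      have h2 : x + f x • e - z = (f x - t₀) • e := by rw [hzdef]; module
      rw [h2, norm_smul, he, mul_one, Real.norm_eq_abs] at h1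
      linarith [neg_le_abs (f x - t₀)]
    have hle : t₀ + (1 + ε) * (f x - t₀) ≤ FK x := by
      have h1 : z + (1 + ε)⁻¹ • (x + FK x • e - z) = x + (t₀ + (1 + ε)⁻¹ * (FK x - t₀)) • e := by
        rw [hzdef]
        module
      have h2 := hscale _ (hFK x hxV).1
      rw [h1] at h2
      have h3 : f x ≤ t₀ + (1 + ε)⁻¹ * (FK x - t₀) := by
        by_contra! hcon
        exact hG.below x hxV _ hcon h2
      have h4 := mul_le_mul_of_nonneg_left (sub_le_iff_le_add'.2 h3) (by positivity : 0 ≤ 1 + ε)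
      rw [mul_inv_cancel_left₀ (by positivity)] at h4
      linarith
    have hv := joinedWithin_vertical he (hFKbelow x hxV) hle le_rfl
    rw [← hq] at hv
    refine le_of_forall_pos_le_add fun r hr => ?_
    have h1 := ((hj.add_eps (ε := r / 2) (by positivity)).scale convex_poly hzK hε hscale
      (s := 1 + θ * ε) (by linarith) (by linarith) hpKint).trans hv
    have h2 := h1.intrinsicDist_le
    rw [← hρ, ← hpKdef, ← hρK] at h2
    have h3 := hFKle x hxV
    have h4 : (1 + ε - (1 + θ * ε)) * ‖p - z‖ ≤ ε * (2 * R) :=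
      mul_le_mul (by linarith) hpz (norm_nonneg _) hε.le
    have h5 : ε * (t₀ - f x) ≤ ε * (2 * R) := mul_le_mul_of_nonneg_left hxt hε.le
    have h6 : (1 + ε) * (r / 2) ≤ r := by nlinarith
    linarith
  have hupper2 : ρK (x + FK x • e) ^ 2 ≤ ((1 + ε) * ρ (x + f x • e) + 4 * R * ε) ^ 2 :=
    pow_le_pow_left₀ (intrinsicDist_nonneg _ _ _) upper 2
  have hA := lower a ha (by simpa using hFKge 0 (by simp))
  have hB := lower b hb (by simpa using hFKge 1 (by simp))
  have hX := hFKge τ hτ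
  rw [← hx] at hX
  have hA' := mul_le_mul_of_nonneg_left hA (sub_nonneg.2 hτ.2)
  have hB' := mul_le_mul_of_nonneg_left hB hτ.1
  have hX' : (2 * (24 * R) + 1) * (f x - η) ≤ (2 * (24 * R) + 1) * FK x :=
    mul_le_mul_of_nonneg_left hX (by positivity)
  linarith

/-- Along a segment in a lower graph, the squared distance from `p` becomes concave after
subtracting an explicit convex function. -/
theorem IsLowerGraph.concave [FiniteDimensional ℝ E]
    (hdim : ∀ u : E, ∃ w : E, ‖w‖ = 1 ∧ ⟪u, w⟫ = 0) (hC : IsCompact C) (hconv : Convex ℝ C)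
    {R : ℝ} (hR : 0 < R) (hCR : C ⊆ Metric.closedBall 0 R) (hG : IsLowerGraph C e V f L)
    (hopen : ∀ x ∈ V, ∃ δ > 0, ∀ u, ⟪e, u⟫ = 0 → ‖u‖ ≤ δ → x + u ∈ V)
    {p : E} (hp : p ∈ frontier C) {a b : E} (ha : a ∈ V) (hb : b ∈ V)
    {τ : ℝ} (hτ : τ ∈ Icc (0 : ℝ) 1) :
    (1 - τ) * (intrinsicDist (interior C)ᶜ p (a + f a • e) ^ 2 - (2 * (24 * R) + 1) * f a) +
      τ * (intrinsicDist (interior C)ᶜ p (b + f b • e) ^ 2 - (2 * (24 * R) + 1) * f b) ≤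
    intrinsicDist (interior C)ᶜ p (a + τ • (b - a) + f (a + τ • (b - a)) • e) ^ 2 -
      (2 * (24 * R) + 1) * f (a + τ • (b - a)) +
      (1 + (L + 1) ^ 2) * ‖b - a‖ ^ 2 * (τ * (1 - τ)) := by
  obtain ⟨δ₁, hδ₁, hb₁⟩ := hopen a ha
  obtain ⟨δ₂, hδ₂, hb₂⟩ := hopen b hb
  have hball : ∀ τ ∈ Icc (0 : ℝ) 1, ∀ u, ⟪e, u⟫ = 0 → ‖u‖ ≤ min δ₁ δ₂ →
      a + τ • (b - a) + u ∈ V := by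
    intro τ hτ u hu hun
    have h := hG.convex.add_smul_sub_mem (hb₁ u hu (hun.trans (min_le_left _ _)))
      (hb₂ u hu (hun.trans (min_le_right _ _))) hτ
    convert h using 1
    module
  have hxV : a + τ • (b - a) ∈ V := hG.convex.add_smul_sub_mem ha hb hτ
  obtain ⟨t₀, -, hz⟩ := hG.above _ hxV
  have hL := hG.nonneg
  have hev : ∀ᶠ ε in nhdsWithin (0 : ℝ) (Ioi 0),
      0 < ε ∧ ε ≤ 1 ∧ (L + 1) * (2 * R * ε) ≤ min δ₁ δ₂ := by
    have h1 : ∀ᶠ ε in nhdsWithin (0 : ℝ) (Ioi 0), 0 < ε := self_mem_nhdsWithin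
    have h2 : ∀ᶠ ε in nhdsWithin (0 : ℝ) (Ioi 0), ε ≤ 1 :=
      nhdsWithin_le_nhds (Iic_mem_nhds one_pos)
    have h3 : ∀ᶠ ε in nhdsWithin (0 : ℝ) (Ioi 0), (L + 1) * (2 * R * ε) ≤ min δ₁ δ₂ := by
      refine nhdsWithin_le_nhds ?_
      have hc : ContinuousAt (fun ε : ℝ => (L + 1) * (2 * R * ε)) 0 := by fun_prop
      exact hc.eventually_le_const (by simpa using ⟨hδ₁, hδ₂⟩)
    exact h1.and (h2.and h3)
  have hlim := fun ε (hε : 0 < ε ∧ ε ≤ 1 ∧ (L + 1) * (2 * R * ε) ≤ min δ₁ δ₂) =>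
    hG.approx_concave hdim hC hconv hR hCR hp ha hb (lt_min hδ₁ hδ₂) hball hτ hz
      hε.1 hε.2.1 hε.2.2
  refine ge_of_tendsto (x := nhdsWithin (0 : ℝ) (Ioi 0)) ?_ (hev.mono hlim)
  refine tendsto_nhdsWithin_of_tendsto_nhds ?_
  refine (Continuous.tendsto' (by fun_prop) 0 _ ?_)
  ring

end Limit

/-! ### Standard charts and the distance from a set -/

section Chart

universe u

variable {E : Type u} [NormedAddCommGroup E] [InnerProductSpace ℝ E]
  {C : Set E} {e : E} {V : Set E} {f : E → ℝ} {L : ℝ}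

lemma mem_interior_of_between (hconv : Convex ℝ C) {x : E} {r s t : ℝ} (hr : x + r • e ∈ C)
    (ht : x + t • e ∈ interior C) (hs : (r < s ∧ s < t) ∨ (t < s ∧ s < r)) :
    x + s • e ∈ interior C := by
  have hne : t - r ≠ 0 := by
    rcases hs with ⟨h1, h2⟩ | ⟨h1, h2⟩
    · exact (by linarith : 0 < t - r).ne'
    · exact (by linarith : t - r < 0).ne
  have h0 : 0 < (s - r) / (t - r) := by
    rcases hs with ⟨h1, h2⟩ | ⟨h1, h2⟩
    · exact div_pos (by linarith) (by linarith)
    · exact div_pos_of_neg_of_neg (by linarith) (by linarith)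
  have h1 : 0 ≤ (t - s) / (t - r) := by
    rcases hs with ⟨h1, h2⟩ | ⟨h1, h2⟩
    · exact div_nonneg (by linarith) (by linarith)
    · exact div_nonneg_of_nonpos (by linarith) (by linarith)
  have h2 : (s - r) / (t - r) + (t - s) / (t - r) = 1 := by
    field_simp
    ring
  have h3 : (s - r) / (t - r) * t + (t - s) / (t - r) * r = s := by
    field_simp
    ring
  have h := hconv.combo_interior_self_mem_interior ht hr h0 h1 h2
  convert h using 1
  calc x + s • e = ((s - r) / (t - r) + (t - s) / (t - r)) • x +
        ((s - r) / (t - r) * t + (t - s) / (t - r) * r) • e := by rw [h2, h3, one_smul]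
    _ = _ := by module

lemma IsLowerGraph.of_above (hC : IsClosed C) (hconv : Convex ℝ C) (he : ‖e‖ = 1)
    (horth : ∀ x ∈ V, ⟪e, x⟫ = 0) (hV : Convex ℝ V) (hL : 0 ≤ L)
    (hlip : ∀ x ∈ V, ∀ y ∈ V, f x ≤ f y + L * ‖x - y‖)
    (hfr : ∀ x ∈ V, x + f x • e ∈ frontier C)
    (habove : ∀ x ∈ V, ∃ t > f x, x + t • e ∈ interior C) : IsLowerGraph C e V f L where
  norm_eq := he
  orth := horth
  convex := hV
  nonneg := hL
  lip := hlip
  mem x hx := hC.frontier_subset (hfr x hx)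
  below x hx t ht htC := by
    obtain ⟨t', ht', h⟩ := habove x hx
    exact (hfr x hx).2 (mem_interior_of_between hconv htC h (Or.inl ⟨ht, ht'⟩))
  above := habove

lemma combo_vertical_mem_interior (hconv : Convex ℝ C) {x r : E} {δ s t : ℝ} (hδ : 0 < δ)
    (hs : x - δ • r + s • e ∈ C) (ht : x + r + t • e ∈ interior C) :
    x + ((s + δ * t) / (1 + δ)) • e ∈ interior C := by
  have hne : (1 + δ) ≠ 0 := by positivity
  have h1 : δ / (1 + δ) + 1 / (1 + δ) = 1 := by
    field_simp
    ring
  have h2 : δ / (1 + δ) - 1 / (1 + δ) * δ = 0 := by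
    field_simp
    ring
  have h3 : δ / (1 + δ) * t + 1 / (1 + δ) * s = (s + δ * t) / (1 + δ) := by
    field_simp
    ring
  have h := hconv.combo_interior_self_mem_interior ht hs (a := δ / (1 + δ)) (b := 1 / (1 + δ))
    (by positivity) (by positivity) h1
  convert h using 1
  calc x + ((s + δ * t) / (1 + δ)) • e = (δ / (1 + δ) + 1 / (1 + δ)) • x +
        (δ / (1 + δ) - 1 / (1 + δ) * δ) • r +
        (δ / (1 + δ) * t + 1 / (1 + δ) * s) • e := by
        rw [h1, h2, h3, one_smul, zero_smul, add_zero]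
    _ = _ := by module

lemma exists_step (hopen : ∀ x ∈ V, ∃ δ > 0, ∀ u, ⟪e, u⟫ = 0 → ‖u‖ ≤ δ → x + u ∈ V)
    {x r : E} (hx : x ∈ V) (hr : ⟪e, r⟫ = 0) : ∃ δ : ℝ, 0 < δ ∧ x - δ • r ∈ V := by
  obtain ⟨δ, hδ, h⟩ := hopen x hx
  refine ⟨δ / (‖r‖ + 1), by positivity, ?_⟩
  rw [sub_eq_add_neg]
  refine h _ (by rw [inner_neg_right, inner_smul_right, hr, mul_zero, neg_zero]) ?_
  rw [norm_neg, norm_smul, Real.norm_of_nonneg (by positivity), div_mul_eq_mul_div,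
    div_le_iff₀ (by positivity)]
  nlinarith [norm_nonneg r]

lemma exists_height_mem_interior (hconv : Convex ℝ C) (hne : (interior C).Nonempty)
    (he : ‖e‖ = 1) (horth : ∀ x ∈ V, ⟪e, x⟫ = 0) (hmem : ∀ x ∈ V, x + f x • e ∈ C)
    (hopen : ∀ x ∈ V, ∃ δ > 0, ∀ u, ⟪e, u⟫ = 0 → ‖u‖ ≤ δ → x + u ∈ V) {x : E} (hx : x ∈ V) :
    ∃ t : ℝ, x + t • e ∈ interior C := by
  obtain ⟨y, hy⟩ := hne
  have hee : ⟪e, e⟫ = 1 := by rw [real_inner_self_eq_norm_sq, he]; norm_num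
  obtain ⟨δ, hδ, h⟩ := exists_step hopen hx (r := y - ⟪e, y⟫ • e - x) (by
    rw [inner_sub_right, inner_sub_right, inner_smul_right, hee, horth x hx]
    ring)
  refine ⟨_, combo_vertical_mem_interior hconv hδ (hmem _ h) (t := ⟪e, y⟫) ?_⟩
  convert hy using 1
  module

lemma exists_height_gt (hconv : Convex ℝ C) (horth : ∀ x ∈ V, ⟪e, x⟫ = 0)
    (hf : ConvexOn ℝ V f) (hmem : ∀ x ∈ V, x + f x • e ∈ C)
    (hopen : ∀ x ∈ V, ∃ δ > 0, ∀ u, ⟪e, u⟫ = 0 → ‖u‖ ≤ δ → x + u ∈ V) {x y : E} (hx : x ∈ V)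
    (hy : y ∈ V) {t : ℝ} (ht : f y < t) (hyt : y + t • e ∈ interior C) :
    ∃ s > f x, x + s • e ∈ interior C := by
  obtain ⟨δ, hδ, h⟩ := exists_step hopen hx (r := y - x) (by
    rw [inner_sub_right, horth x hx, horth y hy, sub_zero])
  refine ⟨_, ?_, combo_vertical_mem_interior hconv hδ (hmem _ h) (t := t)
    (by rwa [add_sub_cancel])⟩
  have h1 : 1 / (1 + δ) + δ / (1 + δ) = 1 := by field_simp
  have h2 : δ / (1 + δ) - 1 / (1 + δ) * δ = 0 := by
    field_simp
    ring
  have h3 := hf.2 h hy (by positivity : 0 ≤ 1 / (1 + δ)) (by positivity : 0 ≤ δ / (1 + δ)) h1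
  have h4 : (1 / (1 + δ)) • (x - δ • (y - x)) + (δ / (1 + δ)) • y = x := by
    calc _ = (1 / (1 + δ) + δ / (1 + δ)) • x + (δ / (1 + δ) - 1 / (1 + δ) * δ) • (y - x) := by
          module
      _ = x := by rw [h1, h2, one_smul, zero_smul, add_zero]
  rw [h4, smul_eq_mul, smul_eq_mul] at h3
  refine h3.trans_lt ?_
  have h5 : δ / (1 + δ) * f y < δ / (1 + δ) * t := mul_lt_mul_of_pos_left ht (by positivity)
  have h6 : (f (x - δ • (y - x)) + δ * t) / (1 + δ) =
      1 / (1 + δ) * f (x - δ • (y - x)) + δ / (1 + δ) * t := by ring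
  linarith

lemma convexOn_sub_sq_iInf (hV : Convex ℝ V) {ι : Type*} [Nonempty ι] {ρ : ι → E → ℝ}
    (hρ : ∀ i x, 0 ≤ ρ i x) {A M : ℝ}
    (key : ∀ i, ∀ a ∈ V, ∀ b ∈ V, ∀ τ ∈ Icc (0 : ℝ) 1,
      (1 - τ) * (ρ i a ^ 2 - M * f a) + τ * (ρ i b ^ 2 - M * f b) ≤
        ρ i (a + τ • (b - a)) ^ 2 - M * f (a + τ • (b - a)) + A * ‖b - a‖ ^ 2 * (τ * (1 - τ))) :
    ConvexOn ℝ V (fun x => A * ‖x‖ ^ 2 + M * f x - (⨅ i, ρ i x) ^ 2) := by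
  refine ⟨hV, fun a ha b hb α τ hα hτ hατ => ?_⟩
  obtain rfl : α = 1 - τ := by linarith
  have hx : (1 - τ) • a + τ • b = a + τ • (b - a) := by module
  rw [hx]
  set x := a + τ • (b - a) with hxdef
  set d : E → ℝ := fun x => ⨅ i, ρ i x with hd
  have hd0 : ∀ x, 0 ≤ d x := fun x => Real.iInf_nonneg fun i => hρ i x
  have hdle : ∀ i x, d x ^ 2 ≤ ρ i x ^ 2 := fun i x =>
    pow_le_pow_left₀ (hd0 x) (ciInf_le ⟨0, by rintro _ ⟨j, rfl⟩; exact hρ j x⟩ i) 2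
  set Q := (1 - τ) * (d a ^ 2 - M * f a) + τ * (d b ^ 2 - M * f b) + M * f x -
    A * ‖b - a‖ ^ 2 * (τ * (1 - τ)) with hQ
  have hQle : ∀ i, Q ≤ ρ i x ^ 2 := fun i => by
    have h1 := key i a ha b hb τ ⟨hτ, by linarith⟩
    have h2 := mul_le_mul_of_nonneg_left (hdle i a) hα
    have h3 := mul_le_mul_of_nonneg_left (hdle i b) hτ
    linarith
  have hQd : Q ≤ d x ^ 2 := by
    have : √Q ≤ d x := le_ciInf fun i => Real.sqrt_le_iff.2 ⟨hρ i x, hQle i⟩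
    exact (Real.sqrt_le_iff.1 this).2
  have hn : ‖x‖ ^ 2 = (1 - τ) * ‖a‖ ^ 2 + τ * ‖b‖ ^ 2 - ‖b - a‖ ^ 2 * (τ * (1 - τ)) := by
    rw [hxdef, norm_add_sq_real, norm_smul, inner_smul_right, inner_sub_right,
      norm_sub_sq_real, mul_pow, Real.norm_of_nonneg hτ, norm_sub_sq_real,
      real_inner_self_eq_norm_sq, real_inner_comm b a]
    ring
  simp only [smul_eq_mul]
  change A * ‖x‖ ^ 2 + M * f x - d x ^ 2 ≤ (1 - τ) * (A * ‖a‖ ^ 2 + M * f a - d a ^ 2) +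
    τ * (A * ‖b‖ ^ 2 + M * f b - d b ^ 2)
  rw [hn]
  linarith

lemma IsLowerGraph.exists_convexOn [FiniteDimensional ℝ E]
    (hdim : ∀ u : E, ∃ w : E, ‖w‖ = 1 ∧ ⟪u, w⟫ = 0) (hC : IsCompact C) (hconv : Convex ℝ C)
    (hne : (interior C).Nonempty) (hG : IsLowerGraph C e V f L)
    (hopen : ∀ x ∈ V, ∃ δ > 0, ∀ u, ⟪e, u⟫ = 0 → ‖u‖ ≤ δ → x + u ∈ V)
    {F : Set E} (hF : F.Nonempty) (hFC : F ⊆ frontier C) :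
    ∃ A M : ℝ, 0 ≤ A ∧ 0 ≤ M ∧ ConvexOn ℝ V (fun x => A * ‖x‖ ^ 2 + M * f x -
      (⨅ y : F, intrinsicDist (frontier C) (x + f x • e) y) ^ 2) := by
  obtain ⟨R, hR, hCR⟩ := hC.isBounded.subset_closedBall_lt 0 0
  obtain ⟨z, hz⟩ := hne
  have : Nonempty F := hF.to_subtype
  have hfr : ∀ x ∈ V, x + f x • e ∈ frontier C := fun x hx => by
    rw [hC.isClosed.frontier_eq]
    exact ⟨hG.mem x hx, notMem_interior_of_below (hG.below x hx) le_rfl⟩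
  have hjoin : ∀ p ∈ frontier C, ∀ q ∈ frontier C,
      JoinedWithin (interior C)ᶜ p q (6 * (2 * R)) := by
    have hzn : ∀ y ∈ C, ‖y - z‖ ≤ 2 * R := fun y hy => by
      have h1 : ‖y‖ ≤ R := by simpa using hCR hy
      have h2 : ‖z‖ ≤ R := by simpa using hCR (interior_subset hz)
      linarith [norm_sub_le y z]
    intro p hp q hq
    exact joinedWithin_outside hdim hconv hz (by positivity)
      (fun y hy => by simpa [dist_eq_norm] using hzn y hy) hp.2 hq.2
      (hzn p (hC.isClosed.frontier_subset hp)) (hzn q (hC.isClosed.frontier_subset hq))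
  have heq : ∀ p ∈ frontier C, ∀ x ∈ V, intrinsicDist (frontier C) (x + f x • e) p =
      intrinsicDist (interior C)ᶜ p (x + f x • e) := fun p hp x hx => by
    have h := hjoin p hp _ (hfr x hx)
    rw [(h.symm.to_frontier hC.isClosed hconv (hfr x hx) hp).intrinsicDist_comm,
      intrinsicDist_frontier hC.isClosed hconv hp (hfr x hx) h]
  refine ⟨1 + (L + 1) ^ 2, 2 * (24 * R) + 1, by positivity, by positivity,
    convexOn_sub_sq_iInf (ρ := fun (y : F) x => intrinsicDist (frontier C) (x + f x • e) y)
      hG.convex (fun _ _ => intrinsicDist_nonneg _ _ _) fun y a ha b hb τ hτ => ?_⟩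
  have hy := hFC y.2
  rw [heq y hy a ha, heq y hy b hb, heq y hy _ (hG.convex.add_smul_sub_mem ha hb hτ)]
  exact hG.concave hdim hC hconv hR hCR hopen hy ha hb hτ

lemma exists_unit_orthogonal [FiniteDimensional ℝ E] (h : 2 ≤ Module.finrank ℝ E) (u : E) :
    ∃ w : E, ‖w‖ = 1 ∧ ⟪u, w⟫ = 0 := by
  have h1 := Submodule.finrank_add_finrank_orthogonal (Submodule.span ℝ {u})
  have h2 : Module.finrank ℝ (Submodule.span ℝ {u}) ≤ 1 := by
    simpa using finrank_span_le_card (R := ℝ) ({u} : Set E)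
  have h3 : (Submodule.span ℝ {u})ᗮ ≠ ⊥ := by
    intro h0
    rw [h0, finrank_bot] at h1
    omega
  obtain ⟨w, hw, hw0⟩ := Submodule.exists_mem_ne_zero_of_ne_bot h3
  have hpos : 0 < ‖w‖ := norm_pos_iff.2 hw0
  refine ⟨‖w‖⁻¹ • w, ?_, ?_⟩
  · rw [norm_smul, norm_inv, norm_norm, inv_mul_cancel₀ hpos.ne']
  · rw [inner_smul_right, Submodule.mem_orthogonal_singleton_iff_inner_right.1 hw, mul_zero]

end Chart

end ConvexSurface

/-- Let `X ⊂ ℝ^{n+1}` be a convex surface, `∅ ≠ F ⊆ X` closed, and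
`d_F(z) = inf_{y ∈ F} dist_X(z,y)`. Then for every standard chart `(e,V)` on `X` with
associated convex function `f`, the function `x ↦ d_F(x + f(x)e)²` is DC on `V`. -/
theorem sq_dist_from_set_isDC (n : ℕ)
    (X : Set (EuclideanSpace ℝ (Fin (n + 1)))) (hX : IsConvexSurface X)
    (F : Set (EuclideanSpace ℝ (Fin (n + 1)))) (hFne : F.Nonempty) (hFcl : IsClosed F)
    (hFX : F ⊆ X)
    (e : EuclideanSpace ℝ (Fin (n + 1)))
    (V : Set ↥((Submodule.span ℝ {e})ᗮ)) (f : ↥((Submodule.span ℝ {e})ᗮ) → ℝ)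
    (hchart : IsStandardChart X e V f) :
    IsDCOn V
      (fun x : ↥((Submodule.span ℝ {e})ᗮ) =>
        (⨅ y : F, intrinsicDist X ((x : EuclideanSpace ℝ (Fin (n + 1))) + f x • e)
          (y : EuclideanSpace ℝ (Fin (n + 1)))) ^ 2) := by
  obtain ⟨C, ⟨hC, hconv, hne⟩, rfl⟩ := hX
  obtain ⟨he, hVo, hV, hf, ⟨L, hL⟩, O, -, hO⟩ := hchart
  have hHmem : ∀ x : EuclideanSpace ℝ (Fin (n + 1)),
      x ∈ (Submodule.span ℝ {e})ᗮ ↔ inner ℝ e x = 0 := fun x =>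
    Submodule.mem_orthogonal_singleton_iff_inner_right
  have hfin := Submodule.finrank_add_finrank_orthogonal (Submodule.span ℝ {e})
  rw [finrank_span_singleton (by rintro rfl; simp at he), finrank_euclideanSpace_fin] at hfin
  rcases Nat.eq_zero_or_pos n with rfl | hn
  · have : Subsingleton ↥((Submodule.span ℝ {e})ᗮ) :=
      (Module.finrank_zero_iff (R := ℝ)).1 (by omega)
    refine ⟨_, fun _ => 0, ⟨hV, fun x _ y _ a b _ _ hab => ?_⟩, convexOn_const 0 hV,
      continuous_of_const (fun x y => by rw [Subsingleton.elim x y]) |>.continuousOn,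
      continuousOn_const, fun x _ => (sub_zero _).symm⟩
    rw [Subsingleton.elim y x, Subsingleton.elim (a • x + b • x) x, ← add_smul, hab, one_smul]
  have hdim := ConvexSurface.exists_unit_orthogonal (E := EuclideanSpace ℝ (Fin (n + 1)))
    (by rw [finrank_euclideanSpace_fin]; omega)
  have hinj : Function.Injective
      (Subtype.val : ↥((Submodule.span ℝ {e})ᗮ) → EuclideanSpace ℝ (Fin (n + 1))) :=
    Subtype.val_injective
  set W : Set (EuclideanSpace ℝ (Fin (n + 1))) := Subtype.val '' V with hW
  set g : EuclideanSpace ℝ (Fin (n + 1)) → ℝ := Function.extend Subtype.val f 0 with hg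
  have hgf : ∀ x : ↥((Submodule.span ℝ {e})ᗮ), g x = f x := fun x => hinj.extend_apply f 0 x
  have hWconv : Convex ℝ W := hV.linear_image ((Submodule.span ℝ {e})ᗮ).subtype
  have horth : ∀ x ∈ W, inner ℝ e x = 0 := by
    rintro _ ⟨x, -, rfl⟩
    exact (hHmem _).1 x.2
  have hgconv : ConvexOn ℝ W g := by
    refine ⟨hWconv, ?_⟩
    rintro _ ⟨x, hx, rfl⟩ _ ⟨y, hy, rfl⟩ a b ha hb hab
    have h := hf.2 hx hy ha hb hab
    rwa [← hgf, ← hgf, ← hgf] at h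
  have hglip : ∀ x ∈ W, ∀ y ∈ W, |g x - g y| ≤ L * ‖x - y‖ := by
    rintro _ ⟨x, hx, rfl⟩ _ ⟨y, hy, rfl⟩
    rw [hgf, hgf, ← Real.dist_eq, ← dist_eq_norm]
    exact hL.dist_le_mul x hx y hy
  have hfr : ∀ x ∈ W, x + g x • e ∈ frontier C := by
    rintro _ ⟨x, hx, rfl⟩
    rw [hgf]
    exact (hO.subset ⟨x, hx, rfl⟩).1
  have hmem := fun x hx => hC.isClosed.frontier_subset (hfr x hx)
  have hopen : ∀ x ∈ W, ∃ δ > 0, ∀ u, inner ℝ e u = 0 → ‖u‖ ≤ δ → x + u ∈ W := by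
    rintro _ ⟨x, hx, rfl⟩
    obtain ⟨δ, hδ, hball⟩ := Metric.isOpen_iff.1 hVo x hx
    refine ⟨δ / 2, by positivity, fun u hu hun => ?_⟩
    refine ⟨x + ⟨u, (hHmem u).2 hu⟩, hball ?_, rfl⟩
    rw [Metric.mem_ball, dist_eq_norm, add_sub_cancel_left]
    exact (show ‖u‖ < δ by linarith)
  have hnormconv : ∀ A : ℝ, 0 ≤ A →
      ConvexOn ℝ V fun x : ↥((Submodule.span ℝ {e})ᗮ) => A * ‖x‖ ^ 2 := fun A hA =>
    ((convexOn_norm hV).pow (fun _ _ => norm_nonneg _) 2).smul hA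
  have pull : ∀ φ : EuclideanSpace ℝ (Fin (n + 1)) → ℝ, ConvexOn ℝ W φ →
      ConvexOn ℝ V fun x : ↥((Submodule.span ℝ {e})ᗮ) => φ x := fun φ hφ => by
    have h := hφ.comp_linearMap ((Submodule.span ℝ {e})ᗮ).subtype
    have hpre : ((Submodule.span ℝ {e})ᗮ).subtype ⁻¹' W = V := hinj.preimage_image V
    rwa [hpre] at h
  by_cases hlow : ∃ y ∈ W, ∃ t > g y, y + t • e ∈ interior C
  · obtain ⟨y, hy, t, ht, hyt⟩ := hlow
    have hG : ConvexSurface.IsLowerGraph C e W g L :=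
      .of_above hC.isClosed hconv he horth hWconv L.2
        (fun x hx y hy => by linarith [le_abs_self (g x - g y), hglip x hx y hy]) hfr
        fun x hx => ConvexSurface.exists_height_gt hconv horth hgconv hmem hopen hx hy ht hyt
    obtain ⟨A, M, hA, hM, hAM⟩ := hG.exists_convexOn hdim hC hconv hne hopen hFne hFX
    have h1 := pull _ hAM
    have h2 : ConvexOn ℝ V fun x : ↥((Submodule.span ℝ {e})ᗮ) => A * ‖x‖ ^ 2 + M * f x :=
      (hnormconv A hA).add (hf.smul hM)
    refine ⟨_, _, h2, h1, h2.continuousOn hVo, h1.continuousOn hVo, fun x _ => ?_⟩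
    simp only [hgf, Submodule.coe_norm]
    ring
  · have habove : ∀ x ∈ W, ∃ t > -g x, x + t • -e ∈ interior C := by
      intro x hx
      obtain ⟨t, ht⟩ := ConvexSurface.exists_height_mem_interior hconv hne he horth hmem hopen hx
      refine ⟨-t, neg_lt_neg ?_, by rwa [neg_smul_neg]⟩
      rcases lt_trichotomy t (g x) with h | rfl | h
      · exact h
      · exact absurd ht (hfr x hx).2
      · exact absurd ⟨x, hx, t, h, ht⟩ hlow
    have hG : ConvexSurface.IsLowerGraph C (-e) W (fun x => -g x) L :=
      .of_above hC.isClosed hconv (by rwa [norm_neg])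
        (fun x hx => by rw [inner_neg_left, horth x hx, neg_zero]) hWconv L.2
        (fun x hx y hy => by linarith [neg_abs_le (g x - g y), hglip x hx y hy])
        (fun x hx => by rw [neg_smul_neg]; exact hfr x hx) habove
    obtain ⟨A, M, hA, hM, hAM⟩ := hG.exists_convexOn hdim hC hconv hne
      (fun x hx => by simpa only [inner_neg_left, neg_eq_zero] using hopen x hx) hFne hFX
    have h1 := (pull _ hAM).add (hf.smul hM)
    have h2 := hnormconv A hA
    refine ⟨_, _, h2, h1, h2.continuousOn hVo, h1.continuousOn hVo, fun x _ => ?_⟩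
    simp only [hgf, Submodule.coe_norm, neg_smul_neg, Pi.add_apply, smul_eq_mul]
    ring
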